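/- arXiv:hep-th/0205114 — 11 statements merged into one kernel-verified Lean document; each statement's English description precedes it below -/
import Mathlib

section
/- Let α be an irreducible finite-dimensional complex representation of N = Stab(ξ). Then the representation of the transformation group algebra F(X×H) on W(ξ,α) is irreducible: every ℂ-linear subspace U ⊆ W(ξ,α) satisfying T_{η,z}(U) ⊆ U for all η ∈ X and z ∈ H equals {0} or all of W(ξ,α). -/
open scoped Classical

noncomputable section

/-- The carrier space `W(ξ,α) = {φ : H → V | φ(xn) = α(n⁻¹)(φ(x))}` of the irreducible
representation `τ^ξ_α` of the transformation group algebra `F(X×H)`. -/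
def Wspace (H : Type*) [Group H] {X : Type*} [MulAction H X] (ξ : X)
    (V : Type*) [AddCommGroup V] [Module ℂ V]
    (α : Representation ℂ (MulAction.stabilizer H ξ) V) : Submodule ℂ (H → V) where
  carrier := {φ | ∀ (x : H) (n : MulAction.stabilizer H ξ), φ (x * (n : H)) = α n⁻¹ (φ x)}
  add_mem' := by
    intro a b ha hb x n
    simp only [Pi.add_apply, ha x n, hb x n, map_add]
  zero_mem' := by
    intro x n
    simp
  smul_mem' := by
    intro c a ha x n
    simp only [Pi.smul_apply, ha x n, map_smul]

/-- The linear operator `T_{η,z}`, i.e. the image of the basis element `δ_η ⊗ δ_z` of the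
transformation group algebra under the representation `τ^ξ_α`:
`(T_{η,z}φ)(x) = φ(z⁻¹x)` if `x•ξ = η`, and `0` otherwise. -/
def Tact (H : Type*) [Group H] {X : Type*} [MulAction H X] (ξ : X)
    (V : Type*) [AddCommGroup V] [Module ℂ V] (η : X) (z : H) :
    (H → V) →ₗ[ℂ] (H → V) where
  toFun φ := fun x => if x • ξ = η then φ (z⁻¹ * x) else 0
  map_add' := by
    intro a b
    funext x
    by_cases h : x • ξ = η <;> simp [h]
  map_smul' := by
    intro c a
    funext x
    by_cases h : x • ξ = η <;> simp [h]

theorem Tact_apply {H X V : Type*} [Group H] [MulAction H X] [AddCommGroup V] [Module ℂ V]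
    (ξ η : X) (z : H) (φ : H → V) (x : H) :
    Tact H ξ V η z φ x = if x • ξ = η then φ (z⁻¹ * x) else 0 := rfl

/-- Every function is the sum of its restrictions to the fibres of `x ↦ x • ξ`. -/
theorem sum_Tact_one {H X V : Type*} [Group H] [Fintype X] [MulAction H X] [AddCommGroup V]
    [Module ℂ V] (ξ : X) (ψ : H → V) : ∑ η, Tact H ξ V η 1 ψ = ψ := by
  funext x
  simp [Finset.sum_apply, Tact_apply]

/-- On the fibre over `h • ξ`, an element of `Wspace` is determined by its value at `h`. -/
theorem Tact_smul_eq_of_apply_one {H X V : Type*} [Group H] [MulAction H X] [AddCommGroup V]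
    [Module ℂ V] {ξ : X} {α : Representation ℂ (MulAction.stabilizer H ξ) V} {φ ψ : H → V}
    (hφ : φ ∈ Wspace H ξ V α) (hψ : ψ ∈ Wspace H ξ V α) {h : H} (hval : φ 1 = ψ h) :
    Tact H ξ V (h • ξ) h φ = Tact H ξ V (h • ξ) 1 ψ := by
  funext x
  rw [Tact_apply, Tact_apply]
  split_ifs with hx
  · have hn : h⁻¹ * x ∈ MulAction.stabilizer H ξ := by
      rw [MulAction.mem_stabilizer_iff, mul_smul, hx, inv_smul_smul]
    have h1 := hφ 1 ⟨h⁻¹ * x, hn⟩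
    have h2 := hψ h ⟨h⁻¹ * x, hn⟩
    simp only [one_mul, mul_inv_cancel_left] at h1 h2
    rw [h1, hval, inv_one, one_mul, h2]
  · rfl

/-- if `α` is an irreducible finite-dimensional complex representation of
`Stab(ξ)`, then the representation of `F(X×H)` on `W(ξ,α)` is irreducible: every
linear subspace `U ⊆ W(ξ,α)` invariant under all the operators `T_{η,z}` is `{0}` or
all of `W(ξ,α)`. -/
theorem statement0 {H X V : Type*} [Group H] [Fintype H] [Fintype X] [MulAction H X]
    [AddCommGroup V] [Module ℂ V] [FiniteDimensional ℂ V]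
    (ξ : X) (α : Representation ℂ (MulAction.stabilizer H ξ) V)
    (hnt : Nontrivial V)
    (hirr : ∀ U : Submodule ℂ V,
      (∀ (n : MulAction.stabilizer H ξ) (v : V), v ∈ U → α n v ∈ U) → U = ⊥ ∨ U = ⊤)
    (U : Submodule ℂ (H → V)) (hUW : U ≤ Wspace H ξ V α)
    (hinv : ∀ (η : X) (z : H), ∀ φ ∈ U, Tact H ξ V η z φ ∈ U) :
    U = ⊥ ∨ U = Wspace H ξ V α := by
  have eval_inv : ∀ (n : MulAction.stabilizer H ξ) (v : V),
      v ∈ U.map (LinearMap.proj 1) → α n v ∈ U.map (LinearMap.proj (1 : H)) := by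
    rintro n _ ⟨φ, hφ, rfl⟩
    refine ⟨_, hinv ξ n φ hφ, ?_⟩
    have h := hUW hφ 1 n⁻¹
    simpa [Tact_apply] using h
  rcases hirr _ eval_inv with hbot | htop
  · left
    refine (Submodule.eq_bot_iff U).2 fun φ hφ => funext fun x => ?_
    have h := (Submodule.eq_bot_iff _).1 hbot _
      (Submodule.mem_map_of_mem (hinv ξ x⁻¹ φ hφ))
    simpa [Tact_apply] using h
  · right
    refine le_antisymm hUW fun ψ hψ => ?_
    rw [← sum_Tact_one ξ ψ]
    refine Submodule.sum_mem _ fun η _ => ?_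
    by_cases hη : ∃ h : H, h • ξ = η
    · obtain ⟨h, rfl⟩ := hη
      obtain ⟨φ, hφ, hval⟩ := htop.ge (Submodule.mem_top (x := ψ h))
      rw [← Tact_smul_eq_of_apply_one (hUW hφ) hψ hval]
      exact hinv _ _ _ hφ
    · have hzero : Tact H ξ V η 1 ψ = 0 :=
        funext fun x => if_neg fun hx => hη ⟨x, hx⟩
      rw [hzero]
      exact U.zero_mem
end
end

section
/- Let ξ₁, ξ₂ ∈ X, let α be an irreducible finite-dimensional complex representation of Stab(ξ₁) and β one of Stab(ξ₂), and let L : W(ξ₁,α) → W(ξ₂,β) be a ℂ-linear map intertwining the two actions, i.e. L∘T_{η,z} = T_{η,z}∘L for all η ∈ X and z ∈ H (with T_{η,z} acting on W(ξ₁,α) in the source and on W(ξ₂,β) in the target). If L ≠ 0 then ξ₁ and ξ₂ lie in the same H-orbit; if moreover ξ₁ = ξ₂, then L ≠ 0 implies that α and β are isomorphic as representations of Stab(ξ₁). -/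
open scoped Classical

noncomputable section

/-- The element of `W(ξ,α)` supported on the stabilizer of `ξ` with value `v` at `1`. -/
def Wsingle (H : Type*) [Group H] {X : Type*} [MulAction H X] (ξ : X)
    (V : Type*) [AddCommGroup V] [Module ℂ V]
    (α : Representation ℂ (MulAction.stabilizer H ξ) V) : V →ₗ[ℂ] (H → V) where
  toFun v := fun y => if h : y ∈ MulAction.stabilizer H ξ then α ⟨y, h⟩⁻¹ v else 0
  map_add' := by
    intro v w
    funext y
    by_cases h : y ∈ MulAction.stabilizer H ξ <;>
      simp only [Pi.add_apply, h, ↓reduceDIte, map_add, add_zero]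
  map_smul' := by
    intro c v
    funext y
    by_cases h : y ∈ MulAction.stabilizer H ξ <;>
      simp only [Pi.smul_apply, h, ↓reduceDIte, map_smul, smul_zero, RingHom.id_apply]

section Wsingle

variable {H X V : Type*} [Group H] [MulAction H X] {ξ : X} [AddCommGroup V] [Module ℂ V]
  {α : Representation ℂ (MulAction.stabilizer H ξ) V}

theorem Wsingle_apply_coe (n : MulAction.stabilizer H ξ) (v : V) :
    Wsingle H ξ V α v n = α n⁻¹ v :=
  dif_pos n.2

theorem Wsingle_apply_of_notMem {y : H} (h : y ∉ MulAction.stabilizer H ξ) (v : V) :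
    Wsingle H ξ V α v y = 0 :=
  dif_neg h

theorem Wsingle_mem (v : V) : Wsingle H ξ V α v ∈ Wspace H ξ V α := by
  intro x n
  by_cases h : x ∈ MulAction.stabilizer H ξ
  · lift x to MulAction.stabilizer H ξ using h
    rw [← Subgroup.coe_mul, Wsingle_apply_coe, Wsingle_apply_coe, mul_inv_rev, map_mul,
      Module.End.mul_apply]
  · have h' : x * n ∉ MulAction.stabilizer H ξ := by
      rwa [Subgroup.mul_mem_cancel_right _ n.2]
    rw [Wsingle_apply_of_notMem h, Wsingle_apply_of_notMem h', map_zero]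

/-- Translating `φ ∈ W(ξ,α)` by `x⁻¹` and cutting off to the stabilizer yields the element
supported there with value `φ x` at `1`. -/
theorem Tact_inv_eq_Wsingle {φ : H → V} (hφ : φ ∈ Wspace H ξ V α) (x : H) :
    Tact H ξ V ξ x⁻¹ φ = Wsingle H ξ V α (φ x) := by
  funext y
  by_cases h : y ∈ MulAction.stabilizer H ξ
  · lift y to MulAction.stabilizer H ξ using h
    rw [Wsingle_apply_coe, ← hφ x y]
    exact (if_pos y.2).trans (by rw [inv_inv])
  · rw [Wsingle_apply_of_notMem h]
    exact if_neg h

theorem Tact_Wsingle (n : MulAction.stabilizer H ξ) (v : V) :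
    Tact H ξ V ξ n (Wsingle H ξ V α v) = Wsingle H ξ V α (α n v) := by
  have h := Tact_inv_eq_Wsingle (Wsingle_mem (α := α) v) (n⁻¹ : MulAction.stabilizer H ξ)
  rwa [Wsingle_apply_coe, inv_inv, Subgroup.coe_inv, inv_inv] at h

end Wsingle

theorem Tact_apply_one {H X V : Type*} [Group H] [MulAction H X] (ξ : X)
    [AddCommGroup V] [Module ℂ V] (z : H) (φ : H → V) :
    Tact H ξ V ξ z φ 1 = φ z⁻¹ :=
  (if_pos (one_smul H ξ)).trans (by rw [mul_one])

/-- **Schur's lemma** for an intertwining linear map between representations without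
nontrivial invariant subspaces. -/
theorem LinearMap.bijective_of_intertwining_of_ne_zero {k G V₁ V₂ : Type*} [Field k] [Monoid G]
    [AddCommGroup V₁] [Module k V₁] [AddCommGroup V₂] [Module k V₂]
    {α : Representation k G V₁} {β : Representation k G V₂}
    (hα : ∀ U : Submodule k V₁, (∀ (n : G) (v : V₁), v ∈ U → α n v ∈ U) → U = ⊥ ∨ U = ⊤)
    (hβ : ∀ U : Submodule k V₂, (∀ (n : G) (v : V₂), v ∈ U → β n v ∈ U) → U = ⊥ ∨ U = ⊤)
    (f : V₁ →ₗ[k] V₂) (hf : ∀ n v, f (α n v) = β n (f v)) (hf0 : f ≠ 0) :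
    Function.Bijective f := by
  constructor
  · refine LinearMap.ker_eq_bot.mp ((hα (LinearMap.ker f) ?_).resolve_right
      fun h => hf0 (LinearMap.ker_eq_top.mp h))
    intro n v hv
    rw [LinearMap.mem_ker] at hv ⊢
    rw [hf, hv, map_zero]
  · refine LinearMap.range_eq_top.mp ((hβ (LinearMap.range f) ?_).resolve_left
      fun h => hf0 (LinearMap.range_eq_bot.mp h))
    rintro n _ ⟨v, rfl⟩
    exact ⟨α n v, hf n v⟩

/-- an intertwiner `L : W(ξ₁,α) → W(ξ₂,β)` between irreducible representations
of the transformation group algebra is nonzero only if `ξ₁` and `ξ₂` lie in the same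
`H`-orbit, and (when `ξ₁ = ξ₂`) only if `α ≅ β`. -/
theorem statement1 {H X V₁ V₂ : Type*} [Group H] [Fintype H] [Fintype X] [MulAction H X]
    [AddCommGroup V₁] [Module ℂ V₁] [FiniteDimensional ℂ V₁]
    [AddCommGroup V₂] [Module ℂ V₂] [FiniteDimensional ℂ V₂]
    (ξ₁ ξ₂ : X)
    (α : Representation ℂ (MulAction.stabilizer H ξ₁) V₁)
    (β : Representation ℂ (MulAction.stabilizer H ξ₂) V₂)
    (hαnt : Nontrivial V₁)
    (hαirr : ∀ U : Submodule ℂ V₁,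
      (∀ (n : MulAction.stabilizer H ξ₁) (v : V₁), v ∈ U → α n v ∈ U) → U = ⊥ ∨ U = ⊤)
    (hβnt : Nontrivial V₂)
    (hβirr : ∀ U : Submodule ℂ V₂,
      (∀ (n : MulAction.stabilizer H ξ₂) (v : V₂), v ∈ U → β n v ∈ U) → U = ⊥ ∨ U = ⊤)
    (L : (H → V₁) →ₗ[ℂ] (H → V₂))
    (hLW : ∀ φ ∈ Wspace H ξ₁ V₁ α, L φ ∈ Wspace H ξ₂ V₂ β)
    (hint : ∀ (η : X) (z : H), ∀ φ ∈ Wspace H ξ₁ V₁ α,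
      L (Tact H ξ₁ V₁ η z φ) = Tact H ξ₂ V₂ η z (L φ))
    (hL : ∃ φ ∈ Wspace H ξ₁ V₁ α, L φ ≠ 0) :
    (∃ h : H, h • ξ₁ = ξ₂) ∧
    (ξ₁ = ξ₂ → ∃ e : V₁ ≃ₗ[ℂ] V₂,
      ∀ (n : H) (hn₁ : n ∈ MulAction.stabilizer H ξ₁) (hn₂ : n ∈ MulAction.stabilizer H ξ₂)
        (v : V₁), e (α ⟨n, hn₁⟩ v) = β ⟨n, hn₂⟩ (e v)) := by
  obtain ⟨φ, hφ, hLφ⟩ := hL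
  obtain ⟨x, hx⟩ := Function.ne_iff.mp hLφ
  have key : L (Tact H ξ₁ V₁ ξ₂ x⁻¹ φ) 1 ≠ 0 := by
    rwa [hint ξ₂ x⁻¹ φ hφ, Tact_apply_one, inv_inv]
  refine ⟨?_, ?_⟩
  · by_contra! hne
    refine key ?_
    have h0 : Tact H ξ₁ V₁ ξ₂ x⁻¹ φ = 0 := funext fun y => if_neg (hne y)
    rw [h0, map_zero, Pi.zero_apply]
  · rintro rfl
    let f : V₁ →ₗ[ℂ] V₂ := LinearMap.proj 1 ∘ₗ L ∘ₗ Wsingle H ξ₁ V₁ α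
    have hf : ∀ n v, f (α n v) = β n (f v) := by
      intro n v
      change L (Wsingle H ξ₁ V₁ α (α n v)) 1 = β n (L (Wsingle H ξ₁ V₁ α v) 1)
      have h := hLW _ (Wsingle_mem (α := α) v) 1 n⁻¹
      rw [one_mul, inv_inv, Subgroup.coe_inv] at h
      rw [← Tact_Wsingle, hint _ _ _ (Wsingle_mem v), Tact_apply_one, h]
    have hf0 : f ≠ 0 := by
      intro h
      rw [Tact_inv_eq_Wsingle hφ] at key
      exact key (LinearMap.congr_fun h (φ x))
    exact ⟨LinearEquiv.ofBijective f
      (LinearMap.bijective_of_intertwining_of_ne_zero hαirr hβirr f hf hf0),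
      fun n hn₁ _ v => hf ⟨n, hn₁⟩ v⟩
end
end

section
/- Fix, for each η in the orbit O = H•ξ, an element x_η ∈ H with x_η•ξ = η. Then for every η ∈ X and h ∈ H, the trace of the operator T_{η,h} on W(ξ,α) equals χ_α(x_η⁻¹ h x_η) if η ∈ O and h•η = η (in which case x_η⁻¹ h x_η ∈ N), and equals 0 otherwise; here χ_α denotes the character of α. -/
open scoped Classical

noncomputable section

/-- The linear map `V → W(ξ,α)` sending `v` to the function supported on the coset `g * Stab(ξ)`
which takes the value `v` at `g`. -/
def cosetExtension {H X V : Type*} [Group H] [MulAction H X] [AddCommGroup V] [Module ℂ V]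
    (ξ : X) (α : Representation ℂ (MulAction.stabilizer H ξ) V) (g : H) :
    V →ₗ[ℂ] Wspace H ξ V α where
  toFun v := ⟨fun y => if hy : y⁻¹ * g ∈ MulAction.stabilizer H ξ then α ⟨y⁻¹ * g, hy⟩ v else 0, by
    intro y n
    have key : (y * (n : H))⁻¹ * g = (n : H)⁻¹ * (y⁻¹ * g) := by group
    by_cases hy : y⁻¹ * g ∈ MulAction.stabilizer H ξ
    · have hyn : (y * (n : H))⁻¹ * g ∈ MulAction.stabilizer H ξ :=
        key ▸ mul_mem (inv_mem n.2) hy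
      simp only [dif_pos hy, dif_pos hyn, ← Module.End.mul_apply, ← map_mul]
      congr 2
      exact Subtype.ext key
    · have hyn : (y * (n : H))⁻¹ * g ∉ MulAction.stabilizer H ξ := by
        rw [key, Subgroup.mul_mem_cancel_left _ (inv_mem n.2)]
        exact hy
      simp only [dif_neg hy, dif_neg hyn, map_zero]⟩
  map_add' v w := by
    ext y
    by_cases hy : y⁻¹ * g ∈ MulAction.stabilizer H ξ <;> simp [hy, -MulAction.mem_stabilizer_iff]
  map_smul' c v := by
    ext y
    by_cases hy : y⁻¹ * g ∈ MulAction.stabilizer H ξ <;> simp [hy, -MulAction.mem_stabilizer_iff]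

theorem cosetExtension_apply {H X V : Type*} [Group H] [MulAction H X] [AddCommGroup V]
    [Module ℂ V] (ξ : X) (α : Representation ℂ (MulAction.stabilizer H ξ) V) (g : H) (v : V)
    (y : H) :
    (cosetExtension ξ α g v : H → V) y =
      if hy : y⁻¹ * g ∈ MulAction.stabilizer H ξ then α ⟨y⁻¹ * g, hy⟩ v else 0 := rfl

theorem inv_mul_mem_stabilizer_iff {H X : Type*} [Group H] [MulAction H X] {ξ : X} {y g : H} :
    y⁻¹ * g ∈ MulAction.stabilizer H ξ ↔ y • ξ = g • ξ := by
  rw [MulAction.mem_stabilizer_iff, mul_smul, inv_smul_eq_iff, eq_comm]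

/-- On `W(ξ,α)`, the operator `T_{η,h}` with `η = g • ξ` is evaluation at `h⁻¹ * g` followed by
`cosetExtension`. -/
theorem Tact_restrict_eq_cosetExtension_comp {H X V : Type*} [Group H] [MulAction H X]
    [AddCommGroup V] [Module ℂ V] (ξ : X) (α : Representation ℂ (MulAction.stabilizer H ξ) V)
    {η : X} {g : H} (hg : g • ξ = η) (h : H)
    (hinv : ∀ φ ∈ Wspace H ξ V α, Tact H ξ V η h φ ∈ Wspace H ξ V α) :
    (Tact H ξ V η h).restrict hinv =
      cosetExtension ξ α g ∘ₗ LinearMap.proj (h⁻¹ * g) ∘ₗ (Wspace H ξ V α).subtype := by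
  refine LinearMap.ext fun φ => Subtype.ext (funext fun y => ?_)
  change (if y • ξ = η then (φ : H → V) (h⁻¹ * y) else 0) =
    (cosetExtension ξ α g ((φ : H → V) (h⁻¹ * g)) : H → V) y
  rw [cosetExtension_apply]
  by_cases hy : y • ξ = η
  · have hyg : y⁻¹ * g ∈ MulAction.stabilizer H ξ :=
      inv_mul_mem_stabilizer_iff.2 (hy.trans hg.symm)
    have hφ := φ.2 (h⁻¹ * g) (⟨y⁻¹ * g, hyg⟩⁻¹)
    rw [inv_inv] at hφ
    rw [if_pos hy, dif_pos hyg, ← hφ]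
    simp [mul_assoc]
  · rw [if_neg hy, dif_neg (by rwa [inv_mul_mem_stabilizer_iff, hg])]

theorem trace_Tact_restrict {H X V : Type*} [Group H] [Finite H] [MulAction H X]
    [AddCommGroup V] [Module ℂ V] [FiniteDimensional ℂ V] (ξ : X)
    (α : Representation ℂ (MulAction.stabilizer H ξ) V)
    {η : X} {g : H} (hg : g • ξ = η) (h : H)
    (hinv : ∀ φ ∈ Wspace H ξ V α, Tact H ξ V η h φ ∈ Wspace H ξ V α) :
    LinearMap.trace ℂ (Wspace H ξ V α) ((Tact H ξ V η h).restrict hinv) =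
      if hN : g⁻¹ * h * g ∈ MulAction.stabilizer H ξ then
        LinearMap.trace ℂ V (α ⟨g⁻¹ * h * g, hN⟩) else 0 := by
  rw [Tact_restrict_eq_cosetExtension_comp ξ α hg, LinearMap.trace_comp_comm']
  have key : (h⁻¹ * g)⁻¹ * g = g⁻¹ * h * g := by group
  split_ifs with hN
  · congr 1
    ext v
    change (cosetExtension ξ α g v : H → V) (h⁻¹ * g) = _
    simp only [cosetExtension_apply, key, dif_pos hN]
  · convert map_zero (LinearMap.trace ℂ V)
    ext v
    change (cosetExtension ξ α g v : H → V) (h⁻¹ * g) = 0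
    simp only [cosetExtension_apply, key, dif_neg hN]

/-- the trace of the operator `T_{η,h}` on `W(ξ,α)` equals
`χ_α(x_η⁻¹ h x_η)` if `η ∈ H•ξ` and `h • η = η`, and `0` otherwise. -/
theorem statement3 {H X V : Type*} [Group H] [Fintype H] [Fintype X] [MulAction H X]
    [AddCommGroup V] [Module ℂ V] [FiniteDimensional ℂ V]
    (ξ : X) (α : Representation ℂ (MulAction.stabilizer H ξ) V)
    (x : X → H) (hx : ∀ η ∈ MulAction.orbit H ξ, x η • ξ = η)
    (η : X) (h : H)
    (hinv : ∀ φ ∈ Wspace H ξ V α, Tact H ξ V η h φ ∈ Wspace H ξ V α) :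
    (∀ (hη : η ∈ MulAction.orbit H ξ) (hh : h • η = η),
      LinearMap.trace ℂ (Wspace H ξ V α) ((Tact H ξ V η h).restrict hinv) =
        LinearMap.trace ℂ V (α ⟨(x η)⁻¹ * h * x η, by
          rw [MulAction.mem_stabilizer_iff, mul_smul, mul_smul, hx η hη, hh, inv_smul_eq_iff]
          exact (hx η hη).symm⟩)) ∧
    (¬ (η ∈ MulAction.orbit H ξ ∧ h • η = η) →
      LinearMap.trace ℂ (Wspace H ξ V α) ((Tact H ξ V η h).restrict hinv) = 0) := by
  refine ⟨fun hη hh => ?_, fun hne => ?_⟩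
  · rw [trace_Tact_restrict ξ α (hx η hη), dif_pos]
  · by_cases hη : η ∈ MulAction.orbit H ξ
    · rw [trace_Tact_restrict ξ α (hx η hη), dif_neg]
      rw [MulAction.mem_stabilizer_iff, mul_smul, mul_smul, hx η hη, inv_smul_eq_iff, hx η hη]
      exact fun hh => hne ⟨hη, hh⟩
    · convert map_zero (LinearMap.trace ℂ (Wspace H ξ V α))
      refine LinearMap.ext fun φ => Subtype.ext (funext fun y => ?_)
      exact if_neg fun hy => hη ⟨y, hy⟩
end
end

section
/- For ξ ∈ X fix, for each η ∈ H•ξ, an element x_η ∈ H with x_η•ξ = η, and for a finite-dimensional complex representation α of Stab(ξ) with character χ_α define χ_{ξ,α} : X×H → ℂ by χ_{ξ,α}(η,h) = χ_α(x_η⁻¹ h x_η) if η ∈ H•ξ and h•η = η, and 0 otherwise. Then: (i) if ξ₁, ξ₂ ∈ X lie in different H-orbits, then Σ_{η∈X} Σ_{h∈H} χ_{ξ₁,α}(η,h)·conj(χ_{ξ₂,β}(η,h)) = 0 for all representations α of Stab(ξ₁) and β of Stab(ξ₂); (ii) if α and β are irreducible representations of Stab(ξ), then Σ_{η∈X} Σ_{h∈H}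 χ_{ξ,α}(η,h)·conj(χ_{ξ,β}(η,h)) equals |H| if α ≅ β and equals 0 otherwise. -/
open scoped Classical

noncomputable section

universe u v w

/-- Irreducibility of a complex representation: the module is nonzero and has no nontrivial
proper invariant subspaces. -/
def IsIrredRep {G : Type*} [Group G] {V : Type*} [AddCommGroup V] [Module ℂ V]
    (α : Representation ℂ G V) : Prop :=
  Nontrivial V ∧ ∀ U : Submodule ℂ V, (∀ (g : G) (v : V), v ∈ U → α g v ∈ U) → U = ⊥ ∨ U = ⊤

/-- The character `χ_{ξ,α}` of the irreducible representation `τ^ξ_α` of the transformation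
group algebra `F(X×H)`: `χ_{ξ,α}(η,h) = χ_α(x_η⁻¹ h x_η)` if `η ∈ H•ξ` and `h•η = η`,
and `0` otherwise. -/
def chiFun (H : Type u) [Group H] {X : Type v} [MulAction H X] (ξ : X)
    (x : X → H) (hx : ∀ η ∈ MulAction.orbit H ξ, x η • ξ = η)
    {V : Type w} [AddCommGroup V] [Module ℂ V]
    (α : Representation ℂ (MulAction.stabilizer H ξ) V) : X → H → ℂ :=
  fun η h =>
    if hη : η ∈ MulAction.orbit H ξ then
      if hh : h • η = η then
        LinearMap.trace ℂ V (α ⟨(x η)⁻¹ * h * x η, by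
          rw [MulAction.mem_stabilizer_iff, mul_smul, mul_smul, hx η hη, hh, inv_smul_eq_iff]
          exact (hx η hη).symm⟩)
      else 0
    else 0

namespace IsIrredRep

variable {G V : Type*} [Group G] [AddCommGroup V] [Module ℂ V] {α : Representation ℂ G V}

theorem isIrreducible (hα : IsIrredRep α) : α.IsIrreducible := by
  obtain ⟨hV, h⟩ := hα
  refine { exists_pair_ne := ⟨⊥, ⊤, fun e => ?_⟩, eq_bot_or_eq_top := fun U => ?_ }
  · exact bot_ne_top (α := Submodule ℂ V) (congrArg Subrepresentation.toSubmodule e)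
  · exact (h U.toSubmodule fun g _ hv => U.apply_mem_toSubmodule g hv).imp
      (fun e => Subrepresentation.toSubmodule_injective e)
      (fun e => Subrepresentation.toSubmodule_injective e)

/-- An irreducible representation of a finite group is spanned by the orbit of any nonzero
vector, hence is finite-dimensional. -/
theorem finiteDimensional [Finite G] (hα : IsIrredRep α) : FiniteDimensional ℂ V := by
  obtain ⟨hV, h⟩ := hα
  obtain ⟨v, hv⟩ := exists_ne (0 : V)
  let U : Submodule ℂ V := Submodule.span ℂ (Set.range fun g => α g v)
  have hvU : v ∈ U := Submodule.subset_span ⟨1, by simp⟩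
  have hU : U = ⊥ ∨ U = ⊤ := by
    refine h U fun g w hw => ?_
    have hle : U ≤ U.comap (α g) := by
      refine Submodule.span_le.2 ?_
      rintro _ ⟨k, rfl⟩
      exact Submodule.subset_span ⟨g * k, by simp⟩
    exact hle hw
  rcases hU with hU | hU
  · exact absurd ((Submodule.mem_bot ℂ).1 (hU ▸ hvU)) hv
  · exact Module.finite_def.2 (hU ▸ Submodule.fg_span (Set.finite_range _))

end IsIrredRep

section UnitaryTrick

open Matrix
open scoped ComplexOrder

variable {G : Type*} [Group G] [Fintype G]

/-- The average of `(A g)ᴴ * A g` over a finite group is a positive definite form which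
intertwines `A g` with `(A g⁻¹)ᴴ`; therefore their traces agree. -/
theorem Matrix.trace_map_inv_eq_star {n : Type*} [Fintype n] [DecidableEq n]
    (A : G →* Matrix n n ℂ) (g : G) : (A g⁻¹).trace = star (A g).trace := by
  let P : Matrix n n ℂ := ∑ k, (A k)ᴴ * A k
  have hP : P.PosDef := by
    have hsum : P = 1 + ∑ k ∈ Finset.univ.erase 1, (A k)ᴴ * A k := by
      dsimp only [P]
      rw [← Finset.add_sum_erase _ _ (Finset.mem_univ (1 : G))]
      simp
    rw [hsum]
    exact PosDef.one.add_posSemidef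
      (posSemidef_sum _ fun k _ => posSemidef_conjTranspose_mul_self (A k))
  have hunit : IsUnit P.det := (Matrix.isUnit_iff_isUnit_det P).1 hP.isUnit
  have hcomm : P * A g⁻¹ = (A g)ᴴ * P := by
    simp only [P, Finset.sum_mul, Finset.mul_sum]
    refine Fintype.sum_equiv (Equiv.mulRight g⁻¹) _ _ fun k => ?_
    rw [Equiv.coe_mulRight, ← mul_assoc, ← conjTranspose_mul, ← map_mul, mul_assoc, ← map_mul]
    simp
  calc (A g⁻¹).trace = (P⁻¹ * (P * A g⁻¹)).trace := by
        rw [← mul_assoc, nonsing_inv_mul _ hunit, one_mul]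
    _ = ((A g)ᴴ).trace := by
        rw [hcomm, trace_mul_comm, mul_assoc, mul_nonsing_inv _ hunit, mul_one]
    _ = star (A g).trace := trace_conjTranspose _

theorem Representation.trace_inv_eq_conj {V : Type*} [AddCommGroup V] [Module ℂ V]
    [FiniteDimensional ℂ V] (α : Representation ℂ G V) (g : G) :
    LinearMap.trace ℂ V (α g⁻¹) = (starRingEnd ℂ) (LinearMap.trace ℂ V (α g)) := by
  let b := Module.finBasis ℂ V
  have h := Matrix.trace_map_inv_eq_star
    ((MonoidHomClass.toMonoidHom (LinearMap.toMatrixAlgEquiv b)).comp α) g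
  simp only [LinearMap.trace_eq_matrix_trace ℂ b]
  exact h

end UnitaryTrick

theorem Representation.sum_trace_mul_conj {G V W : Type*} [Group G] [Fintype G]
    [AddCommGroup V] [Module ℂ V] [AddCommGroup W] [Module ℂ W]
    {α : Representation ℂ G V} {β : Representation ℂ G W}
    (hα : IsIrredRep α) (hβ : IsIrredRep β) :
    ∑ g, LinearMap.trace ℂ V (α g) * (starRingEnd ℂ) (LinearMap.trace ℂ W (β g)) =
      if ∃ e : V ≃ₗ[ℂ] W, ∀ g v, e (α g v) = β g (e v) then (Fintype.card G : ℂ) else 0 := by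
  have := hα.isIrreducible
  have := hβ.isIrreducible
  have := hα.finiteDimensional
  have := hβ.finiteDimensional
  have hcard : (Nat.card G : ℂ) ≠ 0 := Nat.cast_ne_zero.2 Nat.card_pos.ne'
  have : Invertible (Nat.card G : ℂ) := invertibleOfNonzero hcard
  have hiff : Nonempty (Representation.Equiv β α) ↔
      ∃ e : V ≃ₗ[ℂ] W, ∀ g v, e (α g v) = β g (e v) := by
    refine ⟨fun ⟨φ⟩ => ⟨φ.symm.toLinearEquiv, fun g v => φ.symm.toIntertwiningMap.isIntertwining α β g v⟩, ?_⟩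
    rintro ⟨e, he⟩
    exact ⟨(Representation.Equiv.mk e fun g => LinearMap.ext (he g)).symm⟩
  have h := Representation.char_orthonormal α β
  simp only [hiff, Representation.character, Representation.trace_inv_eq_conj] at h
  rw [inv_mul_eq_iff_eq_mul₀ hcard] at h
  rw [h, mul_ite, mul_one, mul_zero, Nat.card_eq_fintype_card]

section ChiFun

variable {H : Type u} [Group H] {X : Type v} [MulAction H X] {ξ : X} {x : X → H}
  {V : Type*} [AddCommGroup V] [Module ℂ V]

theorem chiFun_of_notMem (hx : ∀ η ∈ MulAction.orbit H ξ, x η • ξ = η)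
    (α : Representation ℂ (MulAction.stabilizer H ξ) V) {η : X}
    (hη : η ∉ MulAction.orbit H ξ) (h : H) : chiFun H ξ x hx α η h = 0 :=
  dif_neg hη

theorem chiFun_of_smul_ne (hx : ∀ η ∈ MulAction.orbit H ξ, x η • ξ = η)
    (α : Representation ℂ (MulAction.stabilizer H ξ) V) {η : X} {h : H}
    (hh : h • η ≠ η) : chiFun H ξ x hx α η h = 0 := by
  simp [chiFun, hh]

theorem chiFun_conj (hx : ∀ η ∈ MulAction.orbit H ξ, x η • ξ = η)
    (α : Representation ℂ (MulAction.stabilizer H ξ) V) {η : X}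
    (hη : η ∈ MulAction.orbit H ξ) (n : MulAction.stabilizer H ξ) :
    chiFun H ξ x hx α η (x η * n * (x η)⁻¹) = LinearMap.trace ℂ V (α n) := by
  have hinv : (x η)⁻¹ • η = ξ := inv_smul_eq_iff.2 (hx η hη).symm
  have hh : (x η * n * (x η)⁻¹) • η = η := by
    rw [mul_smul, mul_smul, hinv, MulAction.mem_stabilizer_iff.1 n.2, hx η hη]
  rw [chiFun, dif_pos hη, dif_pos hh]
  congr 2
  ext
  simp [mul_assoc]

theorem sum_chiFun_mul_conj [Fintype H] {W : Type*} [AddCommGroup W] [Module ℂ W]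
    (hx : ∀ η ∈ MulAction.orbit H ξ, x η • ξ = η)
    (α : Representation ℂ (MulAction.stabilizer H ξ) V)
    (β : Representation ℂ (MulAction.stabilizer H ξ) W) {η : X}
    (hη : η ∈ MulAction.orbit H ξ) :
    ∑ h, chiFun H ξ x hx α η h * (starRingEnd ℂ) (chiFun H ξ x hx β η h) =
      ∑ n, LinearMap.trace ℂ V (α n) * (starRingEnd ℂ) (LinearMap.trace ℂ W (β n)) := by
  symm
  refine Fintype.sum_of_injective
    (fun n : MulAction.stabilizer H ξ => x η * n * (x η)⁻¹) (fun m n hmn => ?_) _ _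
    (fun h hh => ?_) (fun n => ?_)
  · exact Subtype.ext (mul_left_cancel (mul_right_cancel hmn))
  · rw [chiFun_of_smul_ne hx α, zero_mul]
    refine fun hfix => hh ⟨⟨(x η)⁻¹ * h * x η, ?_⟩, by simp [mul_assoc]⟩
    rw [MulAction.mem_stabilizer_iff, mul_smul, mul_smul, hx η hη, hfix, inv_smul_eq_iff,
      hx η hη]
  · simp only [chiFun_conj hx _ hη]

theorem sum_sum_chiFun_mul_conj [Fintype H] [Fintype X]
    {W : Type*} [AddCommGroup W] [Module ℂ W]
    (hx : ∀ η ∈ MulAction.orbit H ξ, x η • ξ = η)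
    {α : Representation ℂ (MulAction.stabilizer H ξ) V}
    {β : Representation ℂ (MulAction.stabilizer H ξ) W}
    (hα : IsIrredRep α) (hβ : IsIrredRep β) :
    ∑ η, ∑ h, chiFun H ξ x hx α η h * (starRingEnd ℂ) (chiFun H ξ x hx β η h) =
      if ∃ e : V ≃ₗ[ℂ] W, ∀ n v, e (α n v) = β n (e v) then (Fintype.card H : ℂ) else 0 := by
  rw [← Fintype.sum_of_injective (Subtype.val : MulAction.orbit H ξ → X)
    Subtype.val_injective _ _ (fun η hη => ?_)
    (fun η => (sum_chiFun_mul_conj hx α β η.2).symm)]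
  · rw [Representation.sum_trace_mul_conj hα hβ, Finset.sum_const, Finset.card_univ,
      nsmul_eq_mul, mul_ite, mul_zero, ← Nat.cast_mul,
      MulAction.card_orbit_mul_card_stabilizer_eq_card_group]
  · refine Finset.sum_eq_zero fun h _ => ?_
    rw [chiFun_of_notMem hx α (by simpa using hη), zero_mul]

end ChiFun

/-- orthogonality relations for the characters of the irreducible
representations of the transformation group algebra `F(X×H)`:
(i) characters attached to different `H`-orbits are orthogonal, and
(ii) for irreducible `α`, `β` at the same base point `ξ`, the inner product of the
characters is `|H|` if `α ≅ β` and `0` otherwise. -/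
theorem statement4 {H : Type u} [Group H] [Fintype H] {X : Type v} [Fintype X]
    [MulAction H X] :
    (∀ (ξ₁ ξ₂ : X), ξ₂ ∉ MulAction.orbit H ξ₁ →
      ∀ (x₁ : X → H) (hx₁ : ∀ η ∈ MulAction.orbit H ξ₁, x₁ η • ξ₁ = η)
        (x₂ : X → H) (hx₂ : ∀ η ∈ MulAction.orbit H ξ₂, x₂ η • ξ₂ = η)
        (V₁ : Type w) (_ : AddCommGroup V₁) (_ : Module ℂ V₁)
        (V₂ : Type w) (_ : AddCommGroup V₂) (_ : Module ℂ V₂)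
        (α : Representation ℂ (MulAction.stabilizer H ξ₁) V₁)
        (β : Representation ℂ (MulAction.stabilizer H ξ₂) V₂),
        ∑ η : X, ∑ h : H,
          chiFun H ξ₁ x₁ hx₁ α η h * (starRingEnd ℂ) (chiFun H ξ₂ x₂ hx₂ β η h) = 0) ∧
    (∀ (ξ : X) (x : X → H) (hx : ∀ η ∈ MulAction.orbit H ξ, x η • ξ = η)
        (V₁ : Type w) (_ : AddCommGroup V₁) (_ : Module ℂ V₁)
        (V₂ : Type w) (_ : AddCommGroup V₂) (_ : Module ℂ V₂)
        (α : Representation ℂ (MulAction.stabilizer H ξ) V₁)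
        (β : Representation ℂ (MulAction.stabilizer H ξ) V₂),
        IsIrredRep α → IsIrredRep β →
        ((∃ e : V₁ ≃ₗ[ℂ] V₂, ∀ (n : MulAction.stabilizer H ξ) (v : V₁),
            e (α n v) = β n (e v)) →
          ∑ η : X, ∑ h : H,
            chiFun H ξ x hx α η h * (starRingEnd ℂ) (chiFun H ξ x hx β η h) =
              (Fintype.card H : ℂ)) ∧
        (¬ (∃ e : V₁ ≃ₗ[ℂ] V₂, ∀ (n : MulAction.stabilizer H ξ) (v : V₁),
            e (α n v) = β n (e v)) →
          ∑ η : X, ∑ h : H,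
            chiFun H ξ x hx α η h * (starRingEnd ℂ) (chiFun H ξ x hx β η h) = 0)) := by
  refine ⟨fun ξ₁ ξ₂ hξ x₁ hx₁ x₂ hx₂ V₁ _ _ V₂ _ _ α β => ?_,
    fun ξ x hx V₁ _ _ V₂ _ _ α β hα hβ => ?_⟩
  · refine Finset.sum_eq_zero fun η _ => Finset.sum_eq_zero fun h _ => ?_
    by_cases hη : η ∈ MulAction.orbit H ξ₁
    · have hη' : η ∉ MulAction.orbit H ξ₂ := fun h₂ =>
        hξ (MulAction.orbit_eq_iff.2 hη ▸ MulAction.mem_orbit_symm.1 h₂)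
      rw [chiFun_of_notMem hx₂ β hη', map_zero, mul_zero]
    · rw [chiFun_of_notMem hx₁ α hη, zero_mul]
  · rw [sum_sum_chiFun_mul_conj hx hα hβ]
    exact ⟨fun he => if_pos he, fun he => if_neg he⟩
end
end

section
/- Let G be a finite group and let C ⊆ F(G) be a ℂ-subalgebra containing the constant functions, with S(C) ⊆ C, and such that for each f ∈ C the function (g₁,g₂) ↦ f(g₁g₂) on G×G lies in the ℂ-linear span of the functions (g₁,g₂) ↦ c₁(g₁)·c₂(g₂) with c₁, c₂ ∈ C. Then there exists a normal subgroup K ⊴ G such that C = {f : G → ℂ | f(gk) = f(g) for all g ∈ G and k ∈ K}; in particular every Hopf subalgebra of F(G) is isomorphic to the function algebra F(G/K) for some normal subgroup K of G. -/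
noncomputable section

universe u

/-- The relation of not being separated by the functions in a subalgebra. -/
def Subalgebra.inseparableSetoid {X k : Type*} [Field k] (A : Subalgebra k (X → k)) :
    Setoid X where
  r x y := ∀ f ∈ A, f x = f y
  iseqv :=
    { refl := fun _ _ _ => rfl
      symm := fun h f hf => (h f hf).symm
      trans := fun h₁ h₂ f hf => (h₁ f hf).trans (h₂ f hf) }

theorem Subalgebra.exists_mem_eq_one_eq_zero {X k : Type*} [Field k]
    (A : Subalgebra k (X → k)) {x y : X} (h : ¬ A.inseparableSetoid x y) :
    ∃ f ∈ A, f x = 1 ∧ f y = 0 := by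
  obtain ⟨c, hc, hxy⟩ : ∃ c ∈ A, c x ≠ c y := by
    by_contra! H
    exact h H
  refine ⟨(c x - c y)⁻¹ • (c - algebraMap k (X → k) (c y)),
    A.smul_mem (A.sub_mem hc (A.algebraMap_mem _)) _, ?_, ?_⟩
  · simp [sub_ne_zero.mpr hxy]
  · simp

/-- On a finite set, a subalgebra of functions contains the indicators of its
inseparability classes. -/
theorem Subalgebra.exists_mem_indicator {X k : Type*} [Field k] [Finite X]
    (A : Subalgebra k (X → k)) (x : X) :
    ∃ e ∈ A, e x = 1 ∧ ∀ y, ¬ A.inseparableSetoid x y → e y = 0 := by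
  classical
  have := Fintype.ofFinite X
  have key : ∀ y, ∃ f ∈ A, f x = 1 ∧ (¬ A.inseparableSetoid x y → f y = 0) := by
    intro y
    by_cases h : A.inseparableSetoid x y
    · exact ⟨1, A.one_mem, rfl, fun h' => absurd h h'⟩
    · obtain ⟨f, hf, h₁, h₀⟩ := A.exists_mem_eq_one_eq_zero h
      exact ⟨f, hf, h₁, fun _ => h₀⟩
  choose F hF hF₁ hF₀ using key
  refine ⟨∏ y, F y, A.prod_mem fun y _ => hF y, ?_, fun y hy => ?_⟩
  · simp [Finset.prod_apply, hF₁]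
  · rw [Finset.prod_apply]
    exact Finset.prod_eq_zero (Finset.mem_univ y) (hF₀ y hy)

/-- On a finite set, a subalgebra of functions consists of all functions constant on its
inseparability classes. -/
theorem Subalgebra.mem_iff_forall_inseparableSetoid {X k : Type*} [Field k] [Finite X]
    (A : Subalgebra k (X → k)) (f : X → k) :
    f ∈ A ↔ ∀ x y, A.inseparableSetoid x y → f x = f y := by
  classical
  refine ⟨fun hf x y h => h f hf, fun hf => ?_⟩
  have := Fintype.ofFinite (Quotient A.inseparableSetoid)
  choose e he he₁ he₀ using A.exists_mem_indicator
  have hsum : f = ∑ q : Quotient A.inseparableSetoid, f q.out • e q.out := by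
    funext x
    have hx : A.inseparableSetoid (Quotient.mk A.inseparableSetoid x).out x :=
      Quotient.mk_out x
    rw [Finset.sum_apply, Finset.sum_eq_single (Quotient.mk A.inseparableSetoid x)]
    · rw [Pi.smul_apply, ← hx _ (he _), he₁, hf _ _ hx, smul_eq_mul, mul_one]
    · intro q _ hq
      rw [Pi.smul_apply, he₀ _ _ fun h => hq ?_, smul_zero]
      rw [← q.out_eq]
      exact Quotient.sound h
    · exact fun h => absurd (Finset.mem_univ _) h
  rw [hsum]
  exact A.sum_mem fun q _ => A.smul_mem (he _) _

/-- every Hopf subalgebra of the function algebra `F(G)` of a finite group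
`G` is the algebra of functions constant on the cosets of some normal subgroup `K ⊴ G`
(i.e. it is isomorphic to `F(G/K)`): if `C ⊆ F(G)` is a subalgebra (containing the
constants) with `S(C) ⊆ C` and such that for each `f ∈ C` the function
`(g₁,g₂) ↦ f(g₁g₂)` lies in the span of the products `(g₁,g₂) ↦ c₁(g₁)·c₂(g₂)` with
`c₁, c₂ ∈ C`, then there is a normal subgroup `K ⊴ G` with
`C = {f | f(gk) = f(g) for all g ∈ G, k ∈ K}`. -/
theorem statement7 {G : Type u} [Group G] [Fintype G]
    (C : Subalgebra ℂ (G → ℂ))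
    (hS : ∀ f ∈ C, (fun g : G => f g⁻¹) ∈ C)
    (hΔ : ∀ f ∈ C, (fun p : G × G => f (p.1 * p.2)) ∈ Submodule.span ℂ
      {u : G × G → ℂ | ∃ c₁ ∈ C, ∃ c₂ ∈ C, u = fun p : G × G => c₁ p.1 * c₂ p.2}) :
    ∃ K : Subgroup G, K.Normal ∧
      (C : Set (G → ℂ)) = {f : G → ℂ | ∀ (g k : G), k ∈ K → f (g * k) = f g} := by
  have hmul : ∀ a a' b b' : G, C.inseparableSetoid a a' → C.inseparableSetoid b b' →
      C.inseparableSetoid (a * b) (a' * b') := by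
    intro a a' b b' ha hb f hf
    refine Submodule.span_induction
      (p := fun u _ => u (a, b) = u (a', b')) ?_ rfl ?_ ?_ (hΔ f hf)
    · rintro _ ⟨c₁, h₁, c₂, h₂, rfl⟩
      simp only [ha c₁ h₁, hb c₂ h₂]
    · intro u v _ _ hu hv
      simp only [Pi.add_apply, hu, hv]
    · intro r u _ hu
      simp only [Pi.smul_apply, hu]
  have hrefl : ∀ a, C.inseparableSetoid a a := fun a => Setoid.refl' _ a
  let K : Subgroup G :=
    { carrier := {g | C.inseparableSetoid g 1}
      one_mem' := hrefl 1
      mul_mem' := fun {a b} ha hb => by simpa using hmul a 1 b 1 ha hb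
      inv_mem' := fun {a} ha f hf => by simpa using ha _ (hS f hf) }
  refine ⟨K, ⟨fun n hn g => ?_⟩, ?_⟩
  · have h := hmul _ _ _ _ (hmul _ _ _ _ (hrefl g) hn) (hrefl g⁻¹)
    rwa [mul_one, mul_inv_cancel] at h
  · ext f
    refine ⟨fun hf g k hk => ?_, fun hf => ?_⟩
    · have h := hmul _ _ _ _ (hrefl g) hk
      rw [mul_one] at h
      exact h f hf
    · refine (C.mem_iff_forall_inseparableSetoid f).mpr fun x y hxy => ?_
      have hk : x⁻¹ * y ∈ K := by
        have h := hmul _ _ _ _ (hrefl x⁻¹) (Setoid.symm' _ hxy)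
        rwa [inv_mul_cancel] at h
      simpa using (hf x _ hk).symm
end
end

section
/- T is a Hopf subalgebra of D(H): 1_D ∈ T; F₁•F₂ ∈ T for all F₁, F₂ ∈ T; SF ∈ T for all F ∈ T; and for every F ∈ T the coproduct ΔF, viewed as a function on (H×H)×(H×H), lies in the ℂ-linear span of the functions (x₁,y₁;x₂,y₂) ↦ G₁(x₁,y₁)·G₂(x₂,y₂) with G₁, G₂ ∈ T. (This is the statement that for any normal subgroup K ⊴ H and any subgroup N ≤ H, the subspace F(H/K)⊗ℂN of D(H) is automatically a Hopf subalgebra.) -/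
open scoped Classical

noncomputable section

/-- The product of the quantum double `D(H)`:
`(F₁•F₂)(x,y) = Σ_z F₁(x,z)·F₂(z⁻¹xz, z⁻¹y)`. -/
def Dmul {H : Type*} [Group H] [Fintype H] (F₁ F₂ : H × H → ℂ) : H × H → ℂ :=
  fun p => ∑ z : H, F₁ (p.1, z) * F₂ (z⁻¹ * p.1 * z, z⁻¹ * p.2)

/-- The unit of the quantum double `D(H)`: `1_D(x,y) = δ_{y,e}`. -/
def Done {H : Type*} [Group H] : H × H → ℂ := fun p => if p.2 = 1 then 1 else 0

/-- The coproduct of the quantum double `D(H)`: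
`(ΔF)(x₁,y₁;x₂,y₂) = F(x₁x₂,y₁)` if `y₁ = y₂` and `0` otherwise. -/
def Dcomul {H : Type*} [Group H] (F : H × H → ℂ) : (H × H) × (H × H) → ℂ :=
  fun q => if q.1.2 = q.2.2 then F (q.1.1 * q.2.1, q.1.2) else 0

/-- The counit of the quantum double `D(H)`: `ε(F) = Σ_y F(e,y)`. -/
def Dcounit {H : Type*} [Group H] [Fintype H] (F : H × H → ℂ) : ℂ := ∑ y : H, F (1, y)

/-- The antipode of the quantum double `D(H)`: `(SF)(x,y) = F(y⁻¹x⁻¹y, y⁻¹)`. -/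
def Dantipode {H : Type*} [Group H] (F : H × H → ℂ) : H × H → ℂ :=
  fun p => F (p.2⁻¹ * p.1⁻¹ * p.2, p.2⁻¹)

/-- The subspace `T = F(H/K) ⊗ ℂN` of `D(H)` attached to a normal subgroup `K ⊴ H` and a
subgroup `N ≤ H`: functions constant on `K`-cosets in the first argument and supported on
`N` in the second argument. -/
def Tset {H : Type*} [Group H] (K N : Subgroup H) : Set (H × H → ℂ) :=
  {F | (∀ (x y k : H), k ∈ K → F (x * k, y) = F (x, y)) ∧
       (∀ x y : H, y ∉ N → F (x, y) = 0)}

section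

variable {H : Type*} [Group H] {K N : Subgroup H} {F F₁ F₂ : H × H → ℂ}

/-- Functions constant on left cosets of a normal subgroup are also constant on right cosets. -/
theorem Tset_left_invariant [K.Normal] (hF : F ∈ Tset K N) (x y : H) {k : H} (hk : k ∈ K) :
    F (k * x, y) = F (x, y) := by
  have h := hF.1 x y (x⁻¹ * k * x⁻¹⁻¹) (Subgroup.Normal.conj_mem inferInstance k hk x⁻¹)
  rwa [show x * (x⁻¹ * k * x⁻¹⁻¹) = k * x by group] at h

theorem Done_mem_Tset : (Done : H × H → ℂ) ∈ Tset K N :=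
  ⟨fun _ _ _ _ => rfl, fun _ _ hy => if_neg (ne_of_mem_of_not_mem N.one_mem hy).symm⟩

theorem Dmul_mem_Tset [Fintype H] [K.Normal] (h₁ : F₁ ∈ Tset K N) (h₂ : F₂ ∈ Tset K N) :
    Dmul F₁ F₂ ∈ Tset K N := by
  refine ⟨fun x y k hk => Finset.sum_congr rfl fun z _ => ?_,
    fun x y hy => Finset.sum_eq_zero fun z _ => ?_⟩
  · have h := h₂.1 (z⁻¹ * x * z) (z⁻¹ * y) (z⁻¹ * k * z⁻¹⁻¹)
      (Subgroup.Normal.conj_mem inferInstance k hk z⁻¹)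
    rw [show z⁻¹ * x * z * (z⁻¹ * k * z⁻¹⁻¹) = z⁻¹ * (x * k) * z by group] at h
    simp only [h, h₁.1 x z k hk]
  · by_cases hz : z ∈ N
    · have hzy : z⁻¹ * y ∉ N := fun h => hy ((N.mul_mem_cancel_left (N.inv_mem hz)).1 h)
      simp only [h₂.2 _ _ hzy, mul_zero]
    · simp only [h₁.2 _ _ hz, zero_mul]

theorem Dantipode_mem_Tset [K.Normal] (hF : F ∈ Tset K N) : Dantipode F ∈ Tset K N := by
  refine ⟨fun x y k hk => ?_, fun x y hy => hF.2 _ _ fun h => hy (N.inv_mem_iff.1 h)⟩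
  have h := Tset_left_invariant hF (y⁻¹ * x⁻¹ * y) y⁻¹
    (Subgroup.Normal.conj_mem inferInstance k⁻¹ (K.inv_mem hk) y⁻¹)
  rwa [show y⁻¹ * k⁻¹ * y⁻¹⁻¹ * (y⁻¹ * x⁻¹ * y) = y⁻¹ * (x * k)⁻¹ * y by group] at h

/-- The right translate of `F` by `c`, restricted to the second coordinate `y`. -/
def translateSlice (F : H × H → ℂ) (c y : H) : H × H → ℂ :=
  fun p => if p.2 = y then F (p.1 * c, p.2) else 0

/-- The indicator function of the set `c × {y}`, for a coset `c` of `K`. -/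
def cosetIndicator (K : Subgroup H) (c : H ⧸ K) (y : H) : H × H → ℂ :=
  fun p => if (p.1 : H ⧸ K) = c ∧ p.2 = y then 1 else 0

theorem translateSlice_mem_Tset [K.Normal] (hF : F ∈ Tset K N) (c y : H) :
    translateSlice F c y ∈ Tset K N := by
  refine ⟨fun x y' k hk => ?_, fun x y' hy' => ?_⟩
  · have h := hF.1 (x * c) y' (c⁻¹ * k * c⁻¹⁻¹)
      (Subgroup.Normal.conj_mem inferInstance k hk c⁻¹)
    rw [show x * c * (c⁻¹ * k * c⁻¹⁻¹) = x * k * c by group] at h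
    simp only [translateSlice, h]
  · simp only [translateSlice, hF.2 _ _ hy', ite_self]

theorem cosetIndicator_mem_Tset (c : H ⧸ K) {y : H} (hy : y ∈ N) :
    cosetIndicator K c y ∈ Tset K N := by
  refine ⟨fun x y' k hk => ?_, fun x y' hy' =>
    if_neg (not_and_of_not_right _ (ne_of_mem_of_not_mem hy hy').symm)⟩
  simp only [cosetIndicator, QuotientGroup.mk_mul_of_mem x hk]

theorem Dcomul_eq_sum [Fintype H] (hF : F ∈ Tset K N) :
    Dcomul F = ∑ y : N, ∑ c : H ⧸ K,
      fun q => translateSlice F c.out y q.1 * cosetIndicator K c y q.2 := by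
  ext ⟨⟨x₁, y₁⟩, ⟨x₂, y₂⟩⟩
  have hout : F (x₁ * (x₂ : H ⧸ K).out, y₁) = F (x₁ * x₂, y₁) := by
    obtain ⟨k, hk⟩ := QuotientGroup.mk_out_eq_mul K x₂
    rw [hk, ← mul_assoc, hF.1 _ _ _ k.2]
  simp only [Finset.sum_apply, Dcomul, translateSlice, cosetIndicator]
  have hsum (y : N) : ∑ c : H ⧸ K, (if y₁ = y then F (x₁ * c.out, y₁) else 0) *
      (if (x₂ : H ⧸ K) = c ∧ y₂ = y then 1 else 0) =
      if y₁ = y ∧ y₂ = y then F (x₁ * x₂, y₁) else 0 := by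
    rw [Finset.sum_eq_single (x₂ : H ⧸ K) (fun c _ hc => by simp [hc.symm]) (by simp), hout]
    by_cases h₁ : y₁ = y <;> by_cases h₂ : y₂ = y <;> simp [h₁, h₂]
  simp only [hsum]
  by_cases hy : y₁ ∈ N
  · rw [Finset.sum_eq_single ⟨y₁, hy⟩ (fun y _ hne => if_neg fun h => hne (Subtype.ext h.1.symm))
      (by simp)]
    simp [eq_comm]
  · simp [hF.2 _ _ hy]

end

/-- for any normal subgroup `K ⊴ H` and any subgroup `N ≤ H`, the subspace
`T = F(H/K) ⊗ ℂN` of `D(H)` is a Hopf subalgebra: it contains the unit, is closed under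
the product and the antipode, and its image under the coproduct lies in the span of the
products `G₁ ⊗ G₂` with `G₁, G₂ ∈ T`. -/
theorem statement12 {H : Type*} [Group H] [Fintype H] (K N : Subgroup H) [K.Normal] :
    Done ∈ Tset K N ∧
    (∀ F₁ ∈ Tset K N, ∀ F₂ ∈ Tset K N, Dmul F₁ F₂ ∈ Tset K N) ∧
    (∀ F ∈ Tset K N, Dantipode F ∈ Tset K N) ∧
    (∀ F ∈ Tset K N, Dcomul F ∈ Submodule.span ℂ
      {G : (H × H) × (H × H) → ℂ | ∃ G₁ ∈ Tset K N, ∃ G₂ ∈ Tset K N,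
        G = fun q => G₁ q.1 * G₂ q.2}) := by
  refine ⟨Done_mem_Tset, fun _ h₁ _ h₂ => Dmul_mem_Tset h₁ h₂, fun _ hF => Dantipode_mem_Tset hF,
    fun F hF => ?_⟩
  rw [Dcomul_eq_sum hF]
  exact Submodule.sum_mem _ fun y _ => Submodule.sum_mem _ fun c _ => Submodule.subset_span
    ⟨_, translateSlice_mem_Tset hF c.out y, _, cosetIndicator_mem_Tset c y.2, rfl⟩
end
end

section
/- The projection P commutes with the coproduct of D(H): for every F : H×H → ℂ and all x₁,y₁,x₂,y₂ ∈ H, (Δ(PF))(x₁,y₁;x₂,y₂) = (1/|K|²)·Σ_{k₁∈K}Σ_{k₂∈K} (ΔF)(x₁k₁,y₁;x₂k₂,y₂)·[y₁∈N]·[y₂∈N]; that is, (P⊗P)∘Δ = Δ∘P, where P⊗P acts on functions on (H×H)×(H×H) by applying the K-averaging and N-support-restriction of P in each of the two pairs of arguments. -/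
open scoped Classical

noncomputable section

/-- The orthogonal projection `P` of `D(H)` onto `T`:
`(PF)(x,y) = (1/|K|)·Σ_{k∈K} F(xk,y)` if `y ∈ N` and `0` otherwise. -/
def Pproj {H : Type*} [Group H] [Fintype H] (K N : Subgroup H) (F : H × H → ℂ) :
    H × H → ℂ :=
  fun p => if p.2 ∈ N then (1 / (Nat.card K : ℂ)) * ∑ k : K, F (p.1 * (k : H), p.2) else 0

/-- For `K` normal, the `K`-sum of `f` based at `a * b` may be computed at `a * k * b`, `k ∈ K`. -/
theorem Subgroup.Normal.sum_mul_mul_mul_eq {H M : Type*} [Group H] [AddCommMonoid M]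
    {K : Subgroup H} [Fintype K] (hK : K.Normal) (f : H → M) (a b : H) (k : K) :
    ∑ l : K, f (a * k * (b * l)) = ∑ l : K, f (a * b * l) := by
  have hk : b⁻¹ * k * b ∈ K := by simpa using hK.conj_mem k k.2 b⁻¹
  refine Fintype.sum_equiv (Equiv.mulLeft ⟨b⁻¹ * k * b, hk⟩) _ _ fun l => ?_
  simp [mul_assoc]

/-- the projection `P` commutes with the coproduct of `D(H)`:
`(Δ(PF))(x₁,y₁;x₂,y₂) = (1/|K|²)·Σ_{k₁,k₂∈K} (ΔF)(x₁k₁,y₁;x₂k₂,y₂)·[y₁∈N]·[y₂∈N]`,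
i.e. `(P⊗P)∘Δ = Δ∘P`. -/
theorem statement14 {H : Type*} [Group H] [Fintype H] (K N : Subgroup H) [K.Normal] :
    ∀ (F : H × H → ℂ) (x₁ y₁ x₂ y₂ : H),
      Dcomul (Pproj K N F) ((x₁, y₁), (x₂, y₂)) =
        (1 / (Nat.card K : ℂ) ^ 2) *
          (∑ k₁ : K, ∑ k₂ : K, Dcomul F ((x₁ * (k₁ : H), y₁), (x₂ * (k₂ : H), y₂))) *
          (if y₁ ∈ N then 1 else 0) * (if y₂ ∈ N then 1 else 0) := by
  intro F x₁ y₁ x₂ y₂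
  by_cases hy : y₁ = y₂
  · subst hy
    by_cases hN : y₁ ∈ N
    · have hcard : (Nat.card K : ℂ) ≠ 0 := Nat.cast_ne_zero.mpr Nat.card_pos.ne'
      have hsum (k₁ : K) := Subgroup.Normal.sum_mul_mul_mul_eq ‹K.Normal›
        (fun x => F (x, y₁)) x₁ x₂ k₁
      simp only [Dcomul, Pproj, if_true, if_pos hN, hsum, Finset.sum_const, Finset.card_univ,
        nsmul_eq_mul, ← Nat.card_eq_fintype_card]
      field_simp
    · simp [Dcomul, Pproj, hN]
  · simp [Dcomul, hy]
end
end

section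
/- Γ is a surjective Hopf algebra homomorphism from T onto D' (a realization of the quantum double D(N/(N∩K))): (i) Γf ∈ D' for every f ∈ T; (ii) Γ(F₁•F₂) = (ΓF₁)•'(ΓF₂) for all F₁, F₂ ∈ T, where • is the product of D(H); (iii) Γ(1_D) = 1'; (iv) for all F ∈ T and all x₁,y₁,x₂,y₂ ∈ N, Σ_{k₁∈N∩K}Σ_{k₂∈N∩K} (ΔF)(x₁,y₁k₁;x₂,y₂k₂) = (Δ'(ΓF))(x₁,y₁;x₂,y₂); (v) ε'(ΓF) = ε(F) for all F ∈ T; and (vi) Γ maps T onto all of D'. -/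
open scoped Classical

noncomputable section

/-- The carrier of the realization `D'` of `D(N/(N∩K))`: functions `g : N×N → ℂ`
constant on `(N∩K)`-cosets in both arguments. -/
def DPset {H : Type*} [Group H] (K N : Subgroup H) : Set (↥N × ↥N → ℂ) :=
  {g | (∀ (x y k : ↥N), (k : H) ∈ K → g (x * k, y) = g (x, y)) ∧
       (∀ (x y k : ↥N), (k : H) ∈ K → g (x, y * k) = g (x, y))}

/-- The product of `D'`: `(g₁•'g₂)(x,y) = (1/|N∩K|)·Σ_{z∈N} g₁(x,z)·g₂(z⁻¹xz, z⁻¹y)`. -/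
def DPmul {H : Type*} [Group H] [Fintype H] (K N : Subgroup H)
    (g₁ g₂ : ↥N × ↥N → ℂ) : ↥N × ↥N → ℂ :=
  fun p => (1 / (Nat.card ↥(N ⊓ K) : ℂ)) *
    ∑ z : ↥N, g₁ (p.1, z) * g₂ (z⁻¹ * p.1 * z, z⁻¹ * p.2)

/-- The unit of `D'`: `1'(x,y) = 1` if `y ∈ N∩K`, else `0`. -/
def DPone {H : Type*} [Group H] (K N : Subgroup H) : ↥N × ↥N → ℂ :=
  fun p => if (p.2 : H) ∈ K then 1 else 0

/-- The coproduct of `D'`: `(Δ'g)(x₁,y₁;x₂,y₂) = g(x₁x₂,y₁)` if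
`y₁(N∩K) = y₂(N∩K)` and `0` otherwise. -/
def DPcomul {H : Type*} [Group H] (K N : Subgroup H) (g : ↥N × ↥N → ℂ) :
    (↥N × ↥N) × (↥N × ↥N) → ℂ :=
  fun q => if ((q.1.2 : H))⁻¹ * (q.2.2 : H) ∈ K then g (q.1.1 * q.2.1, q.1.2) else 0

/-- The counit of `D'`: `ε'(g) = (1/|N∩K|)·Σ_{y∈N} g(e,y)`. -/
def DPcounit {H : Type*} [Group H] [Fintype H] (K N : Subgroup H)
    (g : ↥N × ↥N → ℂ) : ℂ :=
  (1 / (Nat.card ↥(N ⊓ K) : ℂ)) * ∑ y : ↥N, g (1, y)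

/-- The Hopf surjection `Γ : T → D'`: `(Γf)(x,y) = Σ_{k∈N∩K} f(x, yk)` for `x, y ∈ N`. -/
def Gmap {H : Type*} [Group H] [Fintype H] (K N : Subgroup H) (f : H × H → ℂ) :
    ↥N × ↥N → ℂ :=
  fun p => ∑ k : ↥(N ⊓ K), f ((p.1 : H), (p.2 : H) * (k : H))

theorem sum_eq_sum_subgroup_of_support {H : Type*} [Group H] [Fintype H] (N : Subgroup H)
    (f : H → ℂ) (hf : ∀ y, y ∉ N → f y = 0) : ∑ y : H, f y = ∑ y : ↥N, f y := by
  rw [← Finset.sum_filter_of_ne (s := Finset.univ) (p := fun y => y ∈ N)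
    (fun y _ hy => by_contra fun h => hy (hf y h))]
  exact Finset.sum_subtype _ (by simp) f

theorem inv_card_mul_sum_const {H : Type*} [Group H] [Fintype H] (L : Subgroup H) (c : ℂ) :
    (1 / (Nat.card ↥L : ℂ)) * ∑ _k : ↥L, c = c := by
  have h : (Nat.card ↥L : ℂ) ≠ 0 := Nat.cast_ne_zero.mpr Nat.card_pos.ne'
  rw [Finset.sum_const, Finset.card_univ, ← Nat.card_eq_fintype_card, nsmul_eq_mul]
  field_simp

/-- If `∑ z, φ k z` does not depend on `k`, averaging over `k` gives this common value. -/
theorem inv_card_mul_sum_eq {H : Type*} [Group H] [Fintype H] (L N : Subgroup H)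
    (φ : ↥N → ↥L → ℂ) (c : ℂ) (h : ∀ k, ∑ z, φ z k = c) :
    (1 / (Nat.card ↥L : ℂ)) * ∑ z : ↥N, ∑ k : ↥L, φ z k = c := by
  rw [Finset.sum_comm, Finset.sum_congr rfl fun k _ => h k, inv_card_mul_sum_const]

theorem Gmap_mem_DPset {H : Type*} [Group H] [Fintype H] {K N : Subgroup H}
    {f : H × H → ℂ} (hf : f ∈ Tset K N) : Gmap K N f ∈ DPset K N := by
  refine ⟨fun x y k hk => ?_, fun x y k hk => ?_⟩
  · exact Finset.sum_congr rfl fun j _ => hf.1 _ _ _ hk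
  · refine Fintype.sum_equiv (Equiv.mulLeft (⟨k, k.2, hk⟩ : ↥(N ⊓ K))) _ _ fun j => ?_
    simp [mul_assoc]

theorem Gmap_Dmul {H : Type*} [Group H] [Fintype H] {K N : Subgroup H} [hK : K.Normal]
    {F₁ F₂ : H × H → ℂ} (h₁ : F₁ ∈ Tset K N) (h₂ : F₂ ∈ Tset K N) :
    Gmap K N (Dmul F₁ F₂) = DPmul K N (Gmap K N F₁) (Gmap K N F₂) := by
  funext ⟨x, y⟩
  have hG := Gmap_mem_DPset h₂
  have hL : Gmap K N (Dmul F₁ F₂) (x, y) =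
      ∑ z : ↥N, F₁ (x, z) * Gmap K N F₂ (z⁻¹ * x * z, z⁻¹ * y) := by
    simp only [Gmap, Dmul, Finset.mul_sum]
    rw [Finset.sum_comm, sum_eq_sum_subgroup_of_support N]
    · simp [mul_assoc]
    · intro z hz
      simp [h₁.2 _ z hz]
  rw [hL]
  symm
  unfold DPmul
  conv_lhs =>
    enter [2, 2, z]
    rw [Gmap, Finset.sum_mul]
  refine inv_card_mul_sum_eq _ _ _ _ fun k => ?_
  let k' : ↥N := ⟨k, k.2.1⟩
  refine Fintype.sum_equiv (Equiv.mulRight k') _ _ fun z => ?_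
  have e₁ : z⁻¹ * x * z = ((z * k')⁻¹ * x * (z * k')) *
      (((z * k')⁻¹ * x * (z * k'))⁻¹ * k' * ((z * k')⁻¹ * x * (z * k')) * k'⁻¹) := by group
  have e₂ : z⁻¹ * y = ((z * k')⁻¹ * y) * (((z * k')⁻¹ * y)⁻¹ * k' * ((z * k')⁻¹ * y)) := by group
  have conj_mem : ∀ w : ↥N, ((w⁻¹ * k' * w : ↥N) : H) ∈ K := fun w => by
    simpa using hK.conj_mem k k.2.2 (w⁻¹ : H)
  have e : Gmap K N F₂ (z⁻¹ * x * z, z⁻¹ * y) =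
      Gmap K N F₂ ((z * k')⁻¹ * x * (z * k'), (z * k')⁻¹ * y) := by
    rw [e₁, hG.1 _ _ _ (K.mul_mem (conj_mem _) (K.inv_mem k.2.2)), e₂, hG.2 _ _ _ (conj_mem _)]
  simp only [e]
  rfl

theorem Gmap_Done {H : Type*} [Group H] [Fintype H] (K N : Subgroup H) :
    Gmap K N Done = DPone K N := by
  funext ⟨x, y⟩
  simp only [Gmap, Done, DPone]
  split_ifs with h
  · rw [Finset.sum_eq_single (⟨(y : H)⁻¹, N.inv_mem y.2, K.inv_mem h⟩ : ↥(N ⊓ K))]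
    · simp
    · intro k _ hk
      refine if_neg fun hyk => hk (Subtype.ext ?_)
      exact eq_inv_of_mul_eq_one_right hyk
    · simp
  · refine Finset.sum_eq_zero fun k _ => if_neg fun hyk => h ?_
    rw [eq_inv_of_mul_eq_one_left hyk]
    exact K.inv_mem k.2.2

theorem sum_Dcomul_eq_DPcomul_Gmap {H : Type*} [Group H] [Fintype H] (K N : Subgroup H)
    (F : H × H → ℂ) (x₁ y₁ x₂ y₂ : ↥N) :
    ∑ k₁ : ↥(N ⊓ K), ∑ k₂ : ↥(N ⊓ K),
        Dcomul F (((x₁ : H), (y₁ : H) * (k₁ : H)), ((x₂ : H), (y₂ : H) * (k₂ : H))) =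
      DPcomul K N (Gmap K N F) ((x₁, y₁), (x₂, y₂)) := by
  simp only [Dcomul, DPcomul, Gmap]
  split_ifs with h
  · refine Finset.sum_congr rfl fun k₁ _ => ?_
    have h' : (y₂ : H)⁻¹ * y₁ ∈ K := by simpa using K.inv_mem h
    rw [Finset.sum_eq_single (⟨(y₂ : H)⁻¹ * y₁ * k₁,
      N.mul_mem (N.mul_mem (N.inv_mem y₂.2) y₁.2) k₁.2.1, K.mul_mem h' k₁.2.2⟩ : ↥(N ⊓ K))]
    · simp [mul_assoc]
    · intro k₂ _ hk
      refine if_neg fun e => hk (Subtype.ext ?_)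
      simp [mul_assoc, e]
    · simp
  · refine Finset.sum_eq_zero fun k₁ _ => Finset.sum_eq_zero fun k₂ _ => if_neg fun e => h ?_
    have : (y₁ : H)⁻¹ * y₂ = k₁ * (k₂ : H)⁻¹ := by
      rw [eq_mul_inv_iff_mul_eq, mul_assoc, ← e, inv_mul_cancel_left]
    rw [this]
    exact K.mul_mem k₁.2.2 (K.inv_mem k₂.2.2)

theorem DPcounit_Gmap {H : Type*} [Group H] [Fintype H] {K N : Subgroup H}
    {F : H × H → ℂ} (hF : F ∈ Tset K N) : DPcounit K N (Gmap K N F) = Dcounit F := by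
  rw [Dcounit, sum_eq_sum_subgroup_of_support N _ fun y hy => hF.2 _ y hy]
  refine inv_card_mul_sum_eq _ _ _ _ fun k => ?_
  exact Fintype.sum_equiv (Equiv.mulRight (⟨k, k.2.1⟩ : ↥N)) _ _ fun z => rfl

theorem exists_Gmap_eq {H : Type*} [Group H] [Fintype H] {K N : Subgroup H}
    {g : ↥N × ↥N → ℂ} (hg : g ∈ DPset K N) : ∃ f ∈ Tset K N, Gmap K N f = g := by
  let f : H × H → ℂ := fun p =>
    if h : p.2 ∈ N ∧ ∃ n : ↥N, (n : H)⁻¹ * p.1 ∈ K then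
      (1 / (Nat.card ↥(N ⊓ K) : ℂ)) * g (h.2.choose, ⟨p.2, h.1⟩)
    else 0
  have hf : ∀ (x : H) (n y : ↥N), (n : H)⁻¹ * x ∈ K →
      f (x, y) = (1 / (Nat.card ↥(N ⊓ K) : ℂ)) * g (n, y) := by
    intro x n y hn
    have h : (y : H) ∈ N ∧ ∃ n : ↥N, (n : H)⁻¹ * x ∈ K := ⟨y.2, n, hn⟩
    have hm := h.2.choose_spec
    have hgm : g (h.2.choose, y) = g (n, y) := by
      have := hg.1 n y (n⁻¹ * h.2.choose) (by
        simpa [mul_assoc] using K.mul_mem hn (K.inv_mem hm))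
      rwa [mul_inv_cancel_left] at this
    rw [← hgm]
    exact dif_pos h
  refine ⟨f, ⟨fun x y k hk => ?_, fun x y hy => dif_neg fun h => hy h.1⟩, ?_⟩
  · by_cases h : y ∈ N ∧ ∃ n : ↥N, (n : H)⁻¹ * x ∈ K
    · obtain ⟨hy, n, hn⟩ := h
      rw [hf x n ⟨y, hy⟩ hn, hf (x * k) n ⟨y, hy⟩ (by
        rw [← mul_assoc]; exact K.mul_mem hn hk)]
    · have h' : ¬ (y ∈ N ∧ ∃ n : ↥N, (n : H)⁻¹ * (x * k) ∈ K) := by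
        rintro ⟨hy, n, hn⟩
        rw [← mul_assoc] at hn
        exact h ⟨hy, n, (K.mul_mem_cancel_right hk).mp hn⟩
      have e : f (x, y) = 0 := dif_neg h
      have e' : f (x * k, y) = 0 := dif_neg h'
      rw [e, e']
  · funext ⟨x, y⟩
    have key : ∀ k : ↥(N ⊓ K), f ((x : H), (y : H) * k) =
        (1 / (Nat.card ↥(N ⊓ K) : ℂ)) * g (x, y) := fun k => by
      rw [← hg.2 x y ⟨k, k.2.1⟩ k.2.2]
      exact hf x x (y * ⟨k, k.2.1⟩) (by simp)
    simp only [Gmap, key]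
    rw [← Finset.mul_sum, inv_card_mul_sum_const]

/-- `Γ` is a surjective Hopf algebra homomorphism from `T` onto `D'`
(a realization of the quantum double `D(N/(N∩K))`). -/
theorem statement15 {H : Type*} [Group H] [Fintype H] (K N : Subgroup H) [K.Normal] :
    (∀ f ∈ Tset K N, Gmap K N f ∈ DPset K N) ∧
    (∀ F₁ ∈ Tset K N, ∀ F₂ ∈ Tset K N,
      Gmap K N (Dmul F₁ F₂) = DPmul K N (Gmap K N F₁) (Gmap K N F₂)) ∧
    Gmap K N Done = DPone K N ∧
    (∀ F ∈ Tset K N, ∀ x₁ y₁ x₂ y₂ : ↥N,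
      ∑ k₁ : ↥(N ⊓ K), ∑ k₂ : ↥(N ⊓ K),
        Dcomul F (((x₁ : H), (y₁ : H) * (k₁ : H)), ((x₂ : H), (y₂ : H) * (k₂ : H))) =
      DPcomul K N (Gmap K N F) ((x₁, y₁), (x₂, y₂))) ∧
    (∀ F ∈ Tset K N, DPcounit K N (Gmap K N F) = Dcounit F) ∧
    (∀ g ∈ DPset K N, ∃ f ∈ Tset K N, Gmap K N f = g) := by
  exact ⟨fun _ hf => Gmap_mem_DPset hf, fun _ h₁ _ h₂ => Gmap_Dmul h₁ h₂, Gmap_Done K N,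
    fun F _ => sum_Dcomul_eq_DPcomul_Gmap K N F, fun _ hF => DPcounit_Gmap hF,
    fun _ hg => exists_Gmap_eq hg⟩
end
end

section
/- The left and right Hopf kernels of Γ are given explicitly by: {f ∈ T | for all x₁,y₁ ∈ N and all x₂,y₂ ∈ H, Σ_{k∈N∩K} f(x₁x₂, y₁k)·[y₁k = y₂] = [y₁ ∈ N∩K]·f(x₂,y₂)} = {f ∈ T | f(x₁x₂,y) = f(x₂,y) for all x₁ ∈ N and x₂, y ∈ H, and f(x,y) = 0 whenever y ∉ N∩K} (the left Hopf kernel), and {f ∈ T | for all x₂,y₂ ∈ N and all x₁,y₁ ∈ H, f(x₁x₂,y₁)·[y₁ ∈ y₂(N∩K)] = f(x₁,y₁)·[y₂ ∈ N∩K]} = {f ∈ T | f(x₁x₂,y) = f(x₁,y) for all x₂ ∈ N and x₁, y ∈ H, and f(x,y) = 0 whenever y ∉ N∩K} (the right Hopf kernel). -/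
open scoped Classical

noncomputable section

/-- Summing `g (yk) · [yk = z]` over `k ∈ M` picks out `g z` exactly when `z` lies in the
coset `yM`. -/
theorem sum_subgroup_mul_ite_eq {H : Type*} [Group H] (M : Subgroup H) [Fintype M]
    (g : H → ℂ) (y z : H) :
    (∑ k : M, g (y * (k : H)) * (if y * (k : H) = z then 1 else 0)) =
      g z * (if y⁻¹ * z ∈ M then 1 else 0) := by
  by_cases h : y⁻¹ * z ∈ M
  · rw [Finset.sum_eq_single (⟨y⁻¹ * z, h⟩ : M)]
    · simp [h]
    · intro k _ hk
      have hne : y * (k : H) ≠ z := by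
        rintro rfl
        exact hk (Subtype.ext (by simp))
      simp [hne]
    · simp
  · rw [if_neg h, mul_zero]
    refine Finset.sum_eq_zero fun k _ => ?_
    have hne : y * (k : H) ≠ z := by
      rintro rfl
      exact h (by simp)
    simp [hne]

/-- The coset form of the Hopf kernel condition, for a family `σ` of transformations of `X`
indexed by `N`, is equivalent to `σ`-invariance together with support in
`N ⊓ K`. -/
theorem coset_condition_iff {H X : Type*} [Group H] (K N : Subgroup H) (σ : N → X → X)
    (f : X → H → ℂ) :
    (∀ (n y₁ : N) (x : X) (y₂ : H),
        f (σ n x) y₂ * (if (y₁ : H)⁻¹ * y₂ ∈ N ⊓ K then 1 else 0) =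
          f x y₂ * (if (y₁ : H) ∈ K then 1 else 0)) ↔
      (∀ (n : N) (x : X) (y : H), f (σ n x) y = f x y) ∧
        ∀ (x : X) (y : H), y ∉ N ⊓ K → f x y = 0 := by
  constructor
  · intro h
    have hsupp : ∀ (x : X) (y : H), y ∉ N ⊓ K → f x y = 0 := by
      intro x y hy
      have h₁ := h 1 1 x y
      rw [OneMemClass.coe_one, inv_one, one_mul, if_neg hy, if_pos K.one_mem] at h₁
      simpa using h₁.symm
    refine ⟨fun n x y => ?_, hsupp⟩
    by_cases hy : y ∈ N ⊓ K
    · have h₁ := h n 1 x y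
      rw [OneMemClass.coe_one, inv_one, one_mul, if_pos hy, if_pos K.one_mem] at h₁
      simpa using h₁
    · rw [hsupp _ y hy, hsupp _ y hy]
  · rintro ⟨hinv, hsupp⟩ n y₁ x y₂
    rw [hinv]
    by_cases hy : y₂ ∈ N ⊓ K
    · have hiff : (y₁ : H)⁻¹ * y₂ ∈ N ⊓ K ↔ (y₁ : H) ∈ K := by
        rw [Subgroup.mul_mem_cancel_right _ hy, inv_mem_iff, Subgroup.mem_inf]
        exact and_iff_right y₁.2
      simp only [hiff]
    · simp [hsupp x y₂ hy]

/-- explicit description of the left and right Hopf kernels of the Hopf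
surjection `Γ : T → D(N/(N∩K))`, `(Γf)(x,y) = Σ_{k∈N∩K} f(x,yk)`: the left Hopf kernel
consists of the `f ∈ T` that are invariant under left multiplication by `N` in the first
argument and supported on `N∩K` in the second, and symmetrically for the right kernel. -/
theorem statement16 {H : Type*} [Group H] [Fintype H] (K N : Subgroup H) [K.Normal] :
    ({f : H × H → ℂ | f ∈ Tset K N ∧ ∀ (x₁ y₁ : ↥N) (x₂ y₂ : H),
        (∑ k : ↥(N ⊓ K), f ((x₁ : H) * x₂, (y₁ : H) * (k : H)) *
          (if (y₁ : H) * (k : H) = y₂ then 1 else 0)) =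
        (if (y₁ : H) ∈ K then 1 else 0) * f (x₂, y₂)} =
      {f : H × H → ℂ | f ∈ Tset K N ∧
        (∀ (x₁ : H), x₁ ∈ N → ∀ (x₂ y : H), f (x₁ * x₂, y) = f (x₂, y)) ∧
        (∀ x y : H, y ∉ N ⊓ K → f (x, y) = 0)}) ∧
    ({f : H × H → ℂ | f ∈ Tset K N ∧ ∀ (x₂ y₂ : ↥N) (x₁ y₁ : H),
        f (x₁ * (x₂ : H), y₁) * (if (y₂ : H)⁻¹ * y₁ ∈ N ⊓ K then 1 else 0) =
        f (x₁, y₁) * (if (y₂ : H) ∈ K then 1 else 0)} =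
      {f : H × H → ℂ | f ∈ Tset K N ∧
        (∀ (x₂ : H), x₂ ∈ N → ∀ (x₁ y : H), f (x₁ * x₂, y) = f (x₁, y)) ∧
        (∀ x y : H, y ∉ N ⊓ K → f (x, y) = 0)}) := by
  constructor
  · ext f
    refine and_congr_right fun _ => ?_
    have key := coset_condition_iff K N (fun n x => (n : H) * x) (fun x y => f (x, y))
    have hsum : ∀ (x₁ y₁ : N) (x₂ y₂ : H),
        (∑ k : ↥(N ⊓ K), f ((x₁ : H) * x₂, (y₁ : H) * (k : H)) *
          (if (y₁ : H) * (k : H) = y₂ then 1 else 0)) =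
        f ((x₁ : H) * x₂, y₂) * (if (y₁ : H)⁻¹ * y₂ ∈ N ⊓ K then 1 else 0) :=
      fun x₁ y₁ x₂ y₂ =>
        sum_subgroup_mul_ite_eq (N ⊓ K) (fun y => f ((x₁ : H) * x₂, y)) y₁ y₂
    simp only [hsum, mul_comm (ite _ _ _)]
    simp only [Subtype.forall] at key ⊢
    exact key
  · ext f
    refine and_congr_right fun _ => ?_
    have key := coset_condition_iff K N (fun n x => x * (n : H)) (fun x y => f (x, y))
    simp only [Subtype.forall] at key ⊢
    exact key
end
end

section
/- The following are equivalent: (i) for all x ∈ H and all indices a, b ∈ {1,…,d}, (ρ(x g_A x⁻¹))_{ab} · φ(g⁻¹x) equals φ(x) if a = b and equals 0 if a ≠ b; (ii) for all x ∈ H, φ(gx) = (χ_ρ(g_A)/d)·φ(x). Moreover, if these conditions hold then the scalar λ = χ_ρ(g_A)/d is a root of unity — indeed λ^m = 1 where m is the order of g in H — and ρ(g_A) = λ·I_d, where I_d is the d×d identity matrix. -/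
noncomputable section

namespace Matrix

open scoped ComplexOrder MatrixOrder

/-- Every finite-dimensional complex matrix representation of a finite group is conjugate to a
unitary one. -/
theorem exists_conj_conjTranspose_mul_self_eq_one {H n : Type*} [Group H] [Fintype H]
    [Fintype n] [DecidableEq n] (ρ : H →* GL n ℂ) :
    ∃ B : GL n ℂ, ∀ h : H,
      ((B * ρ h * B⁻¹ : GL n ℂ) : Matrix n n ℂ)ᴴ * ((B * ρ h * B⁻¹ : GL n ℂ) : Matrix n n ℂ)
        = 1 := by
  set P : Matrix n n ℂ := ∑ h : H, (ρ h : Matrix n n ℂ)ᴴ * (ρ h : Matrix n n ℂ) with hP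
  have hpos : P.PosDef := posDef_sum Finset.univ_nonempty fun h _ ↦
    PosDef.conjTranspose_mul_self _ (mulVec_injective_of_isUnit (ρ h).isUnit)
  have hinv (k : H) : (ρ k : Matrix n n ℂ)ᴴ * P * (ρ k : Matrix n n ℂ) = P := by
    rw [hP, Finset.mul_sum, Finset.sum_mul]
    refine Fintype.sum_equiv (Equiv.mulRight k) _ _ fun h ↦ ?_
    simp [mul_assoc]
  obtain ⟨_, ⟨B, rfl⟩, hB⟩ :=
    CStarAlgebra.isStrictlyPositive_iff_eq_star_mul_self.mp hpos.isStrictlyPositive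
  rw [star_eq_conjTranspose] at hB
  refine ⟨B, fun h ↦ ?_⟩
  have hBB : (B : Matrix n n ℂ) * ((B⁻¹ : GL n ℂ) : Matrix n n ℂ) = 1 := B.mul_inv
  calc _ = (((B⁻¹ : GL n ℂ) : Matrix n n ℂ) : Matrix n n ℂ)ᴴ *
        ((ρ h : Matrix n n ℂ)ᴴ * ((B : Matrix n n ℂ)ᴴ * B) * ρ h) * ((B⁻¹ : GL n ℂ) : Matrix n n ℂ) := by
        simp only [Units.val_mul, conjTranspose_mul, mul_assoc]
    _ = ((B : Matrix n n ℂ) * ((B⁻¹ : GL n ℂ) : Matrix n n ℂ))ᴴ * ((B : Matrix n n ℂ) * ((B⁻¹ : GL n ℂ) : Matrix n n ℂ)) := by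
        rw [← hB, hinv, hB]
        simp only [conjTranspose_mul, mul_assoc]
    _ = 1 := by rw [hBB]; simp

/-- A unitary matrix whose normalized trace has modulus one is scalar. -/
theorem eq_smul_one_of_trace_eq {n : Type*} [Fintype n] [DecidableEq n] {U : Matrix n n ℂ}
    (hU : Uᴴ * U = 1) {c : ℂ} (hc : ‖c‖ = 1) (htr : U.trace = Fintype.card n * c) :
    U = c • 1 := by
  have hcc : star c * c = 1 := by
    rw [Complex.star_def, ← Complex.normSq_eq_conj_mul_self, Complex.normSq_eq_norm_sq, hc]
    simp
  rw [← sub_eq_zero, ← trace_conjTranspose_mul_self_eq_zero_iff]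
  have hexp : (U - c • 1)ᴴ * (U - c • 1) = (1 + star c * c) • 1 - c • Uᴴ - star c • U := by
    simp only [conjTranspose_sub, conjTranspose_smul, conjTranspose_one, sub_mul, mul_sub, hU,
      smul_mul_assoc, mul_smul_comm, one_mul, mul_one]
    module
  rw [hexp, trace_sub, trace_sub, trace_smul, trace_smul, trace_smul, trace_conjTranspose, htr,
    trace_one, smul_eq_mul, smul_eq_mul, smul_eq_mul, star_mul', star_natCast]
  linear_combination (-(Fintype.card n : ℂ)) * hcc

/-- If the normalized character of a complex representation of a finite group has modulus one at
`h`, then `h` acts by a scalar. -/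
theorem map_eq_smul_one_of_norm_trace {H n : Type*} [Group H] [Finite H]
    [Fintype n] [DecidableEq n] (ρ : H →* GL n ℂ) (h : H) {c : ℂ} (hc : ‖c‖ = 1)
    (htr : (ρ h : Matrix n n ℂ).trace = Fintype.card n * c) :
    (ρ h : Matrix n n ℂ) = c • 1 := by
  have := Fintype.ofFinite H
  obtain ⟨B, hB⟩ := exists_conj_conjTranspose_mul_self_eq_one ρ
  have hU := eq_smul_one_of_trace_eq (hB h) hc <| by
    rw [Units.val_mul, Units.val_mul, trace_units_conj, htr]
  calc (ρ h : Matrix n n ℂ) = (B⁻¹ * (B * ρ h * B⁻¹) * B : GL n ℂ) := by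
        congr 1; group
    _ = c • 1 := by
        rw [Units.val_mul, Units.val_mul _ (B * ρ h * B⁻¹), hU]
        simp

end Matrix

/-- An eigenvalue of left translation by an element of finite order `m` is an `m`-th root of
unity. -/
theorem pow_orderOf_eq_one_of_map_mul_eq_smul {H K V : Type*} [Group H] [Field K]
    [AddCommGroup V] [Module K V] {g : H} {φ : H → V} (hφ : φ ≠ 0) {c : K}
    (h : ∀ x, φ (g * x) = c • φ x) : c ^ orderOf g = 1 := by
  obtain ⟨x, hx⟩ := Function.ne_iff.mp hφ
  have hpow (k : ℕ) : φ (g ^ k * x) = c ^ k • φ x := by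
    induction k with
    | zero => simp
    | succ k ih => rw [pow_succ', mul_assoc, h, ih, smul_smul, pow_succ']
  have hfix := hpow (orderOf g)
  rw [pow_orderOf_eq_one, one_mul] at hfix
  exact smul_left_injective K hx (by simpa using hfix.symm)

/-- invariance of a condensate vector under all matrix elements of the
`D(H)*`-irrep `(ρ,g)` (condition (i)) is equivalent to the eigenvalue equation
`φ(gx) = (χ_ρ(g_A)/d)·φ(x)` (condition (ii)); moreover in that case the scalar
`λ = χ_ρ(g_A)/d` satisfies `λ^m = 1` with `m` the order of `g`, and `ρ(g_A) = λ·I`. -/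
theorem statement17 {H : Type*} [Group H] [Fintype H]
    {V : Type*} [AddCommGroup V] [Module ℂ V]
    (gA g : H) (φ : H → V) (hφ : φ ≠ 0)
    (d : ℕ) (hd : 1 ≤ d)
    (ρ : H →* Matrix.GeneralLinearGroup (Fin d) ℂ) :
    ((∀ (x : H) (a b : Fin d),
        (((ρ (x * gA * x⁻¹) : Matrix.GeneralLinearGroup (Fin d) ℂ) :
            Matrix (Fin d) (Fin d) ℂ) a b) • φ (g⁻¹ * x) =
          if a = b then φ x else 0) ↔
      (∀ x : H, φ (g * x) =
        (Matrix.trace ((ρ gA : Matrix (Fin d) (Fin d) ℂ)) / (d : ℂ)) • φ x)) ∧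
    ((∀ x : H, φ (g * x) =
        (Matrix.trace ((ρ gA : Matrix (Fin d) (Fin d) ℂ)) / (d : ℂ)) • φ x) →
      (Matrix.trace ((ρ gA : Matrix (Fin d) (Fin d) ℂ)) / (d : ℂ)) ^ orderOf g = 1 ∧
      (ρ gA : Matrix (Fin d) (Fin d) ℂ) =
        (Matrix.trace ((ρ gA : Matrix (Fin d) (Fin d) ℂ)) / (d : ℂ)) •
          (1 : Matrix (Fin d) (Fin d) ℂ)) := by
  have hd0 : (d : ℂ) ≠ 0 := by exact_mod_cast (by omega : d ≠ 0)
  set c : ℂ := Matrix.trace (ρ gA : Matrix (Fin d) (Fin d) ℂ) / d with hc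
  have key (h : ∀ x : H, φ (g * x) = c • φ x) :
      c ^ orderOf g = 1 ∧ (ρ gA : Matrix (Fin d) (Fin d) ℂ) = c • 1 := by
    have hroot := pow_orderOf_eq_one_of_map_mul_eq_smul hφ h
    refine ⟨hroot, Matrix.map_eq_smul_one_of_norm_trace ρ gA
      (Complex.norm_eq_one_of_pow_eq_one hroot (orderOf_pos g).ne') ?_⟩
    rw [hc, Fintype.card_fin]
    field_simp
  refine ⟨⟨fun h x ↦ ?_, fun h x a b ↦ ?_⟩, key⟩
  · have hsum : (d : ℂ) • φ (g * x) =
        Matrix.trace (ρ gA : Matrix (Fin d) (Fin d) ℂ) • φ x := by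
      have := Finset.sum_congr rfl fun a (_ : a ∈ Finset.univ) ↦ h (g * x) a a
      rw [← Finset.sum_smul, inv_mul_cancel_left] at this
      rw [← Matrix.trace_units_conj (ρ (g * x))]
      simpa [Matrix.trace, Nat.cast_smul_eq_nsmul] using this.symm
    rw [hc, div_eq_inv_mul, mul_smul, ← hsum, inv_smul_smul₀ hd0]
  · have hconj : (ρ (x * gA * x⁻¹) : Matrix (Fin d) (Fin d) ℂ) = c • 1 := by
      rw [map_mul, map_mul, map_inv, Units.val_mul, Units.val_mul, (key h).2]
      simp
    rw [hconj, Matrix.smul_apply, Matrix.one_apply]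
    split_ifs
    · rw [smul_eq_mul, mul_one, ← h, mul_inv_cancel_left]
    · simp
end
end

section
/- For all f₁, f₂ ∈ L and all x, y ∈ H, the D(H) product satisfies (f₁•f₂)(x,y) = Σ_{z∈N∩K} f₁(x,z)·f₂(x,z⁻¹y). In particular L is closed under the product • of D(H), and under this product L is a ℂ-algebra in which multiplication is pointwise in the first argument and is convolution over the group N∩K in the second argument; hence L is isomorphic as a ℂ-algebra to the tensor product of the commutative algebra of functions on the orbit space of H/K under left translation by {nK | n ∈ N} with the group algebra ℂ[N∩K]. -/
open scoped Classical

noncomputable section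

/-- The left Hopf kernel `L` of the Hopf projection of `T` onto `D(N/(N∩K))`:
functions in `T` invariant under left multiplication by `N` in the first argument and
supported on `N∩K` in the second argument. -/
def Lset {H : Type*} [Group H] (K N : Subgroup H) : Set (H × H → ℂ) :=
  {f | f ∈ Tset K N ∧
       (∀ (n : H), n ∈ N → ∀ (x y : H), f (n * x, y) = f (x, y)) ∧
       (∀ x y : H, y ∉ N ⊓ K → f (x, y) = 0)}

/-- `L` as a submodule of `D(H)`. -/
def Lsub {H : Type*} [Group H] (K N : Subgroup H) : Submodule ℂ (H × H → ℂ) where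
  carrier := Lset K N
  add_mem' := by
    rintro a b ⟨⟨ha1, ha2⟩, ha3, ha4⟩ ⟨⟨hb1, hb2⟩, hb3, hb4⟩
    refine ⟨⟨fun x y k hk => ?_, fun x y hy => ?_⟩, fun n hn x y => ?_, fun x y hy => ?_⟩
    · simp only [Pi.add_apply, ha1 x y k hk, hb1 x y k hk]
    · simp only [Pi.add_apply, ha2 x y hy, hb2 x y hy, add_zero]
    · simp only [Pi.add_apply, ha3 n hn x y, hb3 n hn x y]
    · simp only [Pi.add_apply, ha4 x y hy, hb4 x y hy, add_zero]
  zero_mem' :=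
    ⟨⟨fun x y k hk => rfl, fun x y hy => rfl⟩, fun n hn x y => rfl, fun x y hy => rfl⟩
  smul_mem' := by
    rintro c a ⟨⟨ha1, ha2⟩, ha3, ha4⟩
    refine ⟨⟨fun x y k hk => ?_, fun x y hy => ?_⟩, fun n hn x y => ?_, fun x y hy => ?_⟩
    · simp only [Pi.smul_apply, ha1 x y k hk]
    · simp only [Pi.smul_apply, ha2 x y hy, smul_zero]
    · simp only [Pi.smul_apply, ha3 n hn x y]
    · simp only [Pi.smul_apply, ha4 x y hy, smul_zero]

/-- The orbit of the coset `xK` under left translation by `N`. -/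
def cosetOrbit {H : Type*} [Group H] (K N : Subgroup H) (x : H) :
    Quotient (MulAction.orbitRel ↥N (H ⧸ K)) :=
  Quotient.mk _ (x : H ⧸ K)

section LeftHopfKernel

variable {H : Type*} [Group H] {K N : Subgroup H}

theorem cosetOrbit_surjective : Function.Surjective (cosetOrbit K N) := by
  intro q
  obtain ⟨c, rfl⟩ := Quotient.exists_rep q
  obtain ⟨x, rfl⟩ := QuotientGroup.mk_surjective c
  exact ⟨x, rfl⟩

theorem cosetOrbit_mul_right (x : H) {k : H} (hk : k ∈ K) :
    cosetOrbit K N (x * k) = cosetOrbit K N x := by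
  unfold cosetOrbit
  rw [QuotientGroup.mk_mul_of_mem x hk]

theorem cosetOrbit_mul_left {n : H} (hn : n ∈ N) (x : H) :
    cosetOrbit K N (n * x) = cosetOrbit K N x :=
  Quotient.sound ⟨⟨n, hn⟩, rfl⟩

theorem Lset.apply_eq_of_cosetOrbit_eq {f : H × H → ℂ} (hf : f ∈ Lset K N) {x x' : H}
    (h : cosetOrbit K N x = cosetOrbit K N x') (y : H) : f (x, y) = f (x', y) := by
  obtain ⟨n, hn⟩ := Quotient.exact h
  have hn' : (((n : H) * x' : H) : H ⧸ K) = (x : H ⧸ K) := hn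
  have hk := QuotientGroup.eq.1 hn'
  have := hf.1.1 (n * x') y _ hk
  rw [mul_inv_cancel_left, hf.2.1 n n.2] at this
  exact this

/-- On `L` the conjugation twist in the product of `D(H)` is trivial. -/
theorem Dmul_apply_of_mem_Lset [Fintype H] {f₁ f₂ : H × H → ℂ} (h₁ : f₁ ∈ Lset K N)
    (h₂ : f₂ ∈ Lset K N) (x y : H) :
    Dmul f₁ f₂ (x, y) = ∑ z : ↥(N ⊓ K), f₁ (x, (z : H)) * f₂ (x, (z : H)⁻¹ * y) := by
  have hsub := Finset.sum_subtype_of_mem (s := Finset.univ.filter (· ∈ N ⊓ K))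
    (p := (· ∈ N ⊓ K)) (fun z => f₁ (x, z) * f₂ (x, z⁻¹ * y)) (by simp)
  have huniv : (Finset.univ.filter (· ∈ N ⊓ K)).subtype (· ∈ N ⊓ K) = Finset.univ := by
    ext z
    simpa only [Finset.mem_subtype, Finset.mem_filter, Finset.mem_univ, true_and, iff_true]
      using z.2
  rw [huniv] at hsub
  rw [hsub, Finset.sum_filter]
  refine Finset.sum_congr rfl fun z _ => ?_
  split_ifs with hz
  · have : f₂ (z⁻¹ * x * z, z⁻¹ * y) = f₂ (x, z⁻¹ * y) := by
      rw [h₂.1.1 _ _ z hz.2, h₂.2.1 _ (N.inv_mem hz.1)]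
    simp only [this]
  · simp only [h₁.2.2 x z hz, zero_mul]

theorem Dmul_mem_Lset [Fintype H] {f₁ f₂ : H × H → ℂ} (h₁ : f₁ ∈ Lset K N)
    (h₂ : f₂ ∈ Lset K N) : Dmul f₁ f₂ ∈ Lset K N := by
  have hsupp : ∀ x y : H, y ∉ N ⊓ K → Dmul f₁ f₂ (x, y) = 0 := by
    intro x y hy
    rw [Dmul_apply_of_mem_Lset h₁ h₂]
    refine Finset.sum_eq_zero fun z _ => ?_
    rw [h₂.2.2 x _ fun h => hy (by simpa using (N ⊓ K).mul_mem z.2 h), mul_zero]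
  refine ⟨⟨fun x y k hk => ?_, fun x y hy => hsupp x y fun h => hy h.1⟩,
    fun n hn x y => ?_, hsupp⟩
  · simp only [Dmul_apply_of_mem_Lset h₁ h₂, h₁.1.1 _ _ k hk, h₂.1.1 _ _ k hk]
  · simp only [Dmul_apply_of_mem_Lset h₁ h₂, h₁.2.1 n hn, h₂.2.1 n hn]

variable (K N) in
/-- An element of `L` is a family of functions on the orbit space of `H/K` indexed by `N∩K`. -/
def LsubEquivFun :
    Lsub K N ≃ₗ[ℂ] (↥(N ⊓ K) → Quotient (MulAction.orbitRel ↥N (H ⧸ K)) → ℂ) where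
  toFun f m q := f.1 (Function.surjInv cosetOrbit_surjective q, m)
  map_add' _ _ := rfl
  map_smul' _ _ := rfl
  invFun g := ⟨fun p => if h : p.2 ∈ N ⊓ K then g ⟨p.2, h⟩ (cosetOrbit K N p.1) else 0,
    ⟨fun x y k hk => by simp only [cosetOrbit_mul_right x hk],
      fun x y hy => dif_neg fun h => hy h.1⟩,
    fun n hn x y => by simp only [cosetOrbit_mul_left hn x], fun x y hy => dif_neg hy⟩
  left_inv f := by
    ext ⟨x, y⟩
    by_cases hy : y ∈ N ⊓ K
    · simp only [dif_pos hy]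
      exact Lset.apply_eq_of_cosetOrbit_eq f.2 (Function.surjInv_eq cosetOrbit_surjective _) y
    · simp only [dif_neg hy]
      exact (f.2.2.2 x y hy).symm
  right_inv g := by
    ext m q
    simp only [dif_pos m.2, Function.surjInv_eq cosetOrbit_surjective q]

end LeftHopfKernel

section Convolution

open scoped TensorProduct

variable (A M : Type*) [CommRing A] [Algebra ℂ A] [Fintype M]

/-- Functions from a finite group `M` to `A`, as elements of `A ⊗ ℂ[M]`. -/
def funEquivTensorMonoidAlgebra : (M → A) ≃ₗ[ℂ] A ⊗[ℂ] MonoidAlgebra ℂ M :=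
  (Finsupp.linearEquivFunOnFinite ℂ A M).symm ≪≫ₗ
    (TensorProduct.equivFinsuppOfBasisRight (MonoidAlgebra.basis M ℂ)).symm

variable {A M}

theorem funEquivTensorMonoidAlgebra_apply (g : M → A) :
    funEquivTensorMonoidAlgebra A M g = ∑ m, g m ⊗ₜ[ℂ] MonoidAlgebra.single m (1 : ℂ) := by
  simp [funEquivTensorMonoidAlgebra, TensorProduct.equivFinsuppOfBasisRight_symm_apply,
    Finsupp.sum_fintype]

theorem funEquivTensorMonoidAlgebra_convolution [Group M] (g₁ g₂ : M → A) :
    funEquivTensorMonoidAlgebra A M (fun m => ∑ z, g₁ z * g₂ (z⁻¹ * m)) =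
      funEquivTensorMonoidAlgebra A M g₁ * funEquivTensorMonoidAlgebra A M g₂ := by
  simp only [funEquivTensorMonoidAlgebra_apply, Finset.sum_mul_sum, TensorProduct.sum_tmul,
    Algebra.TensorProduct.tmul_mul_tmul, MonoidAlgebra.single_mul_single, mul_one]
  rw [Finset.sum_comm]
  refine Finset.sum_congr rfl fun z _ => ?_
  exact Fintype.sum_equiv (Equiv.mulLeft z⁻¹) _ _ fun m => by simp

end Convolution


/-- on the left Hopf kernel `L`, the `D(H)` product is pointwise in the
first argument and convolution over `N∩K` in the second argument; in particular `L` is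
closed under the product, and as a `ℂ`-algebra `L` is isomorphic to the tensor product
of the algebra of functions on the orbit space of `H/K` under left translation by
`{nK | n ∈ N}` with the group algebra `ℂ[N∩K]`. -/
theorem statement19 {H : Type*} [Group H] [Fintype H] (K N : Subgroup H) [K.Normal] :
    (∀ f₁ ∈ Lset K N, ∀ f₂ ∈ Lset K N, ∀ x y : H,
      Dmul f₁ f₂ (x, y) = ∑ z : ↥(N ⊓ K), f₁ (x, (z : H)) * f₂ (x, (z : H)⁻¹ * y)) ∧
    (∀ f₁ ∈ Lset K N, ∀ f₂ ∈ Lset K N, Dmul f₁ f₂ ∈ Lset K N) ∧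
    (∃ e : Lsub K N ≃ₗ[ℂ]
        TensorProduct ℂ (Quotient (MulAction.orbitRel ↥N (H ⧸ K)) → ℂ)
          (MonoidAlgebra ℂ ↥(N ⊓ K)),
      ∀ (f₁ f₂ : Lsub K N) (h : Dmul f₁.1 f₂.1 ∈ Lsub K N),
        e ⟨Dmul f₁.1 f₂.1, h⟩ = e f₁ * e f₂) := by
  refine ⟨fun f₁ h₁ f₂ h₂ => Dmul_apply_of_mem_Lset h₁ h₂,
    fun f₁ h₁ f₂ h₂ => Dmul_mem_Lset h₁ h₂,
    LsubEquivFun K N ≪≫ₗ funEquivTensorMonoidAlgebra _ _, fun f₁ f₂ h => ?_⟩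
  simp only [LinearEquiv.trans_apply]
  rw [← funEquivTensorMonoidAlgebra_convolution]
  congr 1
  ext m q
  simpa [LsubEquivFun] using Dmul_apply_of_mem_Lset f₁.2 f₂.2 _ (m : H)
end
end
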